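/- arXiv:2204.04772 — 5 statements merged into one kernel-verified Lean document; each statement's English description precedes it below -/
import Mathlib

section
/- Let n ≥ 2 be an integer, V a finite-dimensional complex vector space of dimension n+1, and ρ a group homomorphism from the symmetric group on {1,…,n+2} to the group of linear automorphisms of V such that the only subspaces of V invariant under ρ(σ) for every σ are 0 and V (i.e. ρ is irreducible). Let v1,…,v_{n+2} be nonzero vectors of V such that: (i) every subfamily of n+1 of them is linearly independent; and (ii) for every permutation σ and every index i there is a nonzero scalar c with ρ(σ)(v_i) = c·v_{σ(i)}. Then for every integer m with 1 ≤ m ≤ n+1 and every vector u ∈ V not lying in the span of v_{m+1},…,v_{n+2}, the span of the set {ρ(σ)(u) : σ a permutation fixing each of m+1,…,n+2} together with v_{m+1},…,v_{n+2} is all of V. -/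
/-- Lemma TECH0 of the paper, in linear terms: let `ρ` be an irreducible
linear action of the symmetric group on `{1,…,n+2}` on a complex vector space `V` of
dimension `n+1`, and `v₁,…,v_{n+2}` nonzero vectors such that every subfamily of `n+1` of
them is linearly independent and `ρ(σ)(vᵢ)` is a nonzero multiple of `v_{σ(i)}` for all `σ, i`.
Then for `1 ≤ m ≤ n+1` and any `u ∉ ⟨v_{m+1},…,v_{n+2}⟩`, the orbit of `u` under the
permutations fixing `m+1,…,n+2`, together with `v_{m+1},…,v_{n+2}`, spans `V`.
(Indices shifted down by one: `vᵢ` is `v i` for `i : Fin (n+2)`, and `v_{m+1},…,v_{n+2}`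
corresponds to the indices `i` with `m ≤ i`.) -/
theorem stmt14 (n : ℕ) (hn : 2 ≤ n) (V : Type*) [AddCommGroup V] [Module ℂ V]
    [FiniteDimensional ℂ V] (hdim : Module.finrank ℂ V = n + 1)
    (ρ : Equiv.Perm (Fin (n + 2)) →* (V ≃ₗ[ℂ] V))
    (hirr : ∀ U : Submodule ℂ V, (∀ σ, ∀ x ∈ U, ρ σ x ∈ U) → U = ⊥ ∨ U = ⊤)
    (v : Fin (n + 2) → V) (hv : ∀ i, v i ≠ 0)
    (hgen : ∀ s : Finset (Fin (n + 2)), s.card = n + 1 →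
      LinearIndependent ℂ (fun i : s => v i.1))
    (hperm : ∀ σ i, ∃ c : ℂ, c ≠ 0 ∧ ρ σ (v i) = c • v (σ i))
    (m : ℕ) (hm1 : 1 ≤ m) (hm2 : m ≤ n + 1) (u : V)
    (hu : u ∉ Submodule.span ℂ (v '' {i | m ≤ (i : ℕ)})) :
    Submodule.span ℂ
        ((fun σ => ρ σ u) ''
            {σ : Equiv.Perm (Fin (n + 2)) | ∀ i : Fin (n + 2), m ≤ (i : ℕ) → σ i = i}
          ∪ v '' {i | m ≤ (i : ℕ)}) = ⊤ := by
  classical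
  -- relations with a vanishing coefficient are trivial
  have hrel : ∀ b : Fin (n + 2) → ℂ, ∑ i, b i • v i = 0 → ∀ k, b k = 0 → ∀ i, b i = 0 := by
    intro b hb k hk i
    by_cases hik : i = k
    · rw [hik, hk]
    have hli := hgen (Finset.univ.erase k) (by simp)
    rw [Fintype.linearIndependent_iff] at hli
    have h2 := hli (fun i => b i.1) (by
      rw [Finset.sum_coe_sort (Finset.univ.erase k) (fun i => b i • v i)]
      rw [← hb, ← Finset.add_sum_erase Finset.univ _ (Finset.mem_univ k), hk]
      simp)
    exact h2 ⟨i, by simp [hik]⟩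
  obtain ⟨a, ha, ha0⟩ : ∃ a : Fin (n + 2) → ℂ, ∑ i, a i • v i = 0 ∧ ∀ i, a i ≠ 0 := by
    have hnl : ¬ LinearIndependent ℂ v := by
      intro h
      have := h.fintype_card_le_finrank
      simp [hdim] at this
    obtain ⟨a, ha, i, hi⟩ := Fintype.not_linearIndependent_iff.1 hnl
    exact ⟨a, ha, fun k hk => hi (hrel a ha k hk i)⟩
  obtain ⟨w, hw⟩ : ∃ w : Fin (n + 2) → V, ∀ i, w i = a i • v i := ⟨_, fun _ => rfl⟩
  have hvw : ∀ i, v i = (a i)⁻¹ • w i := fun i => by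
    rw [hw, smul_smul, inv_mul_cancel₀ (ha0 i), one_smul]
  have hw0 : ∑ i, w i = 0 := by simpa [hw] using ha
  have hrelw : ∀ b : Fin (n + 2) → ℂ, ∑ i, b i • w i = 0 → ∀ i k, b i = b k := by
    intro b hb i k
    have := hrel (fun i => (b i - b k) * a i) (by
      simp only [mul_smul, ← hw, sub_smul, Finset.sum_sub_distrib, ← Finset.smul_sum, hw0, hb]
      simp) k (by simp) i
    exact sub_eq_zero.1 ((mul_eq_zero.1 this).resolve_right (ha0 i))
  have hchi : ∀ σ, ∃ c : ℂ, c ≠ 0 ∧ ∀ i, ρ σ (w i) = c • w (σ i) := by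
    intro σ
    choose c hc0 hc using hperm σ
    have h1 : ∀ i, ρ σ (w i) = (a i * c i * (a (σ i))⁻¹) • w (σ i) := by
      intro i
      rw [hw i, map_smul, hc, hvw (σ i), smul_smul, smul_smul]
    have h2 : ∑ j, (fun j => a (σ.symm j) * c (σ.symm j) * (a j)⁻¹) j • w j = 0 := by
      rw [← Equiv.sum_comp σ]
      simp only [Equiv.symm_apply_apply, ← h1]
      rw [← map_sum, hw0, map_zero]
    refine ⟨a (σ.symm 0) * c (σ.symm 0) * (a 0)⁻¹, ?_, fun i => ?_⟩
    · exact mul_ne_zero (mul_ne_zero (ha0 _) (hc0 _)) (inv_ne_zero (ha0 _))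
    · rw [h1, ← hrelw _ h2 (σ i) 0]
      simp
  have hspan : ⊤ ≤ Submodule.span ℂ (Set.range w) := by
    have hli := hgen (Finset.univ.erase 0) (by simp)
    rw [← hli.span_eq_top_of_card_eq_finrank' (by simp [hdim]), Submodule.span_le]
    rintro _ ⟨i, rfl⟩
    simp only [hvw]
    exact Submodule.smul_mem _ _ (Submodule.subset_span ⟨_, rfl⟩)
  obtain ⟨b, hb⟩ := (Submodule.mem_span_range_iff_exists_fun ℂ).1 (hspan (Submodule.mem_top (x := u)))
  set W := Submodule.span ℂ
        ((fun σ => ρ σ u) ''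
            {σ : Equiv.Perm (Fin (n + 2)) | ∀ i : Fin (n + 2), m ≤ (i : ℕ) → σ i = i}
          ∪ v '' {i | m ≤ (i : ℕ)}) with hW
  have hWorb : ∀ σ : Equiv.Perm (Fin (n + 2)),
      (∀ i : Fin (n + 2), m ≤ (i : ℕ) → σ i = i) → ρ σ u ∈ W := fun σ hσ =>
    Submodule.subset_span (Or.inl ⟨σ, hσ, rfl⟩)
  have hWv : ∀ i : Fin (n + 2), m ≤ (i : ℕ) → v i ∈ W := fun i hi =>
    Submodule.subset_span (Or.inr ⟨i, hi, rfl⟩)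
  have hWw : ∀ i : Fin (n + 2), m ≤ (i : ℕ) → w i ∈ W := fun i hi => by
    rw [hw]
    exact W.smul_mem _ (hWv i hi)
  have huW : u ∈ W := by simpa using hWorb 1 (by simp)
  have hinv : ∀ σ : Equiv.Perm (Fin (n + 2)),
      (∀ i : Fin (n + 2), m ≤ (i : ℕ) → σ i = i) → ∀ x ∈ W, ρ σ x ∈ W := by
    intro σ hσ
    suffices h : W ≤ W.comap (ρ σ).toLinearMap from fun x hx => h hx
    conv_lhs => rw [hW]
    rw [Submodule.span_le]
    rintro _ (⟨τ, hτ, rfl⟩ | ⟨i, hi, rfl⟩)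
    · have := hWorb (σ * τ) (fun i hi => by rw [Equiv.Perm.mul_apply, hτ i hi, hσ i hi])
      rw [map_mul] at this
      exact this
    · obtain ⟨c, -, hc⟩ := hperm σ i
      change ρ σ (v i) ∈ W
      rw [hc, hσ i hi]
      exact W.smul_mem _ (hWv i hi)
  have hswap : ∀ i j : Fin (n + 2), (i : ℕ) < m → (j : ℕ) < m →
      ∀ k : Fin (n + 2), m ≤ (k : ℕ) → Equiv.swap i j k = k := by
    intro i j hi hj k hk
    apply Equiv.swap_apply_of_ne_of_ne
    · rintro rfl; omega
    · rintro rfl; omega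
  obtain ⟨i, j, hi, hj, hij⟩ : ∃ i j : Fin (n + 2), (i : ℕ) < m ∧ (j : ℕ) < m ∧ b i ≠ b j := by
    by_contra! hcon
    apply hu
    have hu2 : u = ∑ i, (b i - b 0) • w i := by
      simp only [sub_smul, Finset.sum_sub_distrib, ← Finset.smul_sum, hw0, hb]
      simp
    rw [hu2]
    refine Submodule.sum_mem _ fun i _ => ?_
    by_cases hi : (i : ℕ) < m
    · rw [hcon i 0 hi (by simp; omega)]
      simp
    · rw [hw]
      exact Submodule.smul_mem _ _ (Submodule.smul_mem _ _
        (Submodule.subset_span ⟨i, by simpa using hi, rfl⟩))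
  have hne : i ≠ j := fun h => hij (by rw [h])
  have hd : w j - w i ∈ W := by
    obtain ⟨c, hc0, hc⟩ := hchi (Equiv.swap i j)
    have h1 : ρ (Equiv.swap i j) u - c • u ∈ W :=
      W.sub_mem (hWorb _ (hswap i j hi hj)) (W.smul_mem _ huW)
    have h2 : ρ (Equiv.swap i j) u - c • u = (c * (b i - b j)) • (w j - w i) := by
      rw [← hb, map_sum, Finset.smul_sum, ← Finset.sum_sub_distrib,
        ← Finset.sum_subset (Finset.subset_univ {i, j}), Finset.sum_pair hne]
      · simp only [map_smul, hc, Equiv.swap_apply_left, Equiv.swap_apply_right]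
        module
      · intro k _ hk
        simp only [Finset.mem_insert, Finset.mem_singleton, not_or] at hk
        rw [map_smul, hc, Equiv.swap_apply_of_ne_of_ne hk.1 hk.2]
        module
    rw [h2] at h1
    exact (W.smul_mem_iff (mul_ne_zero hc0 (sub_ne_zero.2 hij))).1 h1
  have hd2 : ∀ k : Fin (n + 2), (k : ℕ) < m → w k - w i ∈ W := by
    intro k hk
    by_cases hki : k = i
    · simp [hki]
    obtain ⟨c, hc0, hc⟩ := hchi (Equiv.swap j k)
    have h1 := hinv _ (hswap j k hj hk) _ hd
    rw [map_sub, hc, hc, Equiv.swap_apply_left,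
      Equiv.swap_apply_of_ne_of_ne hne (Ne.symm hki), ← smul_sub] at h1
    exact (W.smul_mem_iff hc0).1 h1
  have hwi : w i ∈ W := by
    have h1 : ∑ k : Fin (n + 2), (w k - if (k : ℕ) < m then w i else 0) ∈ W := by
      refine W.sum_mem fun k _ => ?_
      split_ifs with hk
      · exact hd2 k hk
      · simpa using hWw k (by omega)
    rw [Finset.sum_sub_distrib, hw0, zero_sub, ← Finset.sum_filter, Finset.sum_const,
      W.neg_mem_iff, ← Nat.cast_smul_eq_nsmul ℂ] at h1
    refine (W.smul_mem_iff ?_).1 h1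
    rw [Nat.cast_ne_zero]
    exact Finset.card_ne_zero_of_mem (a := i) (by simp [hi])
  rw [eq_top_iff]
  refine hspan.trans (Submodule.span_le.2 ?_)
  rintro _ ⟨k, rfl⟩
  by_cases hk : (k : ℕ) < m
  · simpa using W.add_mem (hd2 k hk) hwi
  · exact hWw k (by omega)
end

section
/- Let n ≥ 2 be an integer and W a complex vector space. Suppose given, for each pair of indices i < j in {1,…,n+3}, a nonzero vector w_{ij} ∈ W (set w_{ji} = w_{ij}), satisfying: (H1) for each i, the n+2 vectors w_{ij} (j ≠ i) span a subspace P_i of dimension n+1, and any n+1 of them are linearly independent; (H2) for all i ≠ j, the intersection P_i ∩ P_j is the line spanned by w_{ij}; (H3) there is a group homomorphism ρ from the symmetric group on {1,…,n+3} to the group of linear automorphisms of W such that (a) for every permutation σ and every pair i < j there is a nonzero scalar c with ρ(σ)(w_{ij}) = c·w_{σ(i)σ(j)}, and (b) for each i, the only subspaces of P_i invariant under ρ(σ) for every σ fixing i are 0 and P_i. Then the span of all the vectors w_{ij} has dimension at least (n+1)(n+2)/2 − 1. -/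
/-- The subspace `P_i` spanned by the `n+2` vectors `w_{ij}`, `j ≠ i`. -/
noncomputable def Pspace {W : Type*} [AddCommGroup W] [Module ℂ W]
    (n : ℕ) (w : Fin (n + 3) → Fin (n + 3) → W) (i : Fin (n + 3)) : Submodule ℂ W :=
  Submodule.span ℂ {x | ∃ j, j ≠ i ∧ x = w i j}

section Helpers

variable {W : Type*} [AddCommGroup W] [Module ℂ W] {n : ℕ}

/-- A normalised transposition operator: it fixes every `w x y` with `x, y` outside `{a, b}`. -/
lemma exists_transp (w : Fin (n + 3) → Fin (n + 3) → W)
    (hsym : ∀ i j, w i j = w j i)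
    (ρ : Equiv.Perm (Fin (n + 3)) →* (W ≃ₗ[ℂ] W))
    (hequiv : ∀ σ i j, i ≠ j → ∃ c : ℂ, c ≠ 0 ∧ ρ σ (w i j) = c • w (σ i) (σ j))
    (a b c d : Fin (n + 3)) (hac : a ≠ c) (had : a ≠ d) (hbc : b ≠ c)
    (hbd : b ≠ d) (hcd : c ≠ d) :
    ∃ T : W →ₗ[ℂ] W,
      (∀ x y, x ≠ y → x ≠ a → x ≠ b → y ≠ a → y ≠ b → T (w x y) = w x y) ∧
      (∀ x y, x ≠ y →
        ∃ k : ℂ, T (w x y) = k • w (Equiv.swap a b x) (Equiv.swap a b y)) := by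
  obtain ⟨e, he, hev⟩ := hequiv (Equiv.swap a b) c d hcd
  rw [Equiv.swap_apply_of_ne_of_ne hac.symm hbc.symm,
    Equiv.swap_apply_of_ne_of_ne had.symm hbd.symm] at hev
  have step : ∀ x y z, x ≠ y → x ≠ z → y ≠ a → y ≠ b → z ≠ a → z ≠ b →
      ρ (Equiv.swap a b) (w x y) = e • w x y → ρ (Equiv.swap a b) (w x z) = e • w x z := by
    intro x y z hxy hxz hya hyb hza hzb h
    obtain ⟨k, hk, hkv⟩ := hequiv (Equiv.swap y z) x y hxy
    rw [Equiv.swap_apply_of_ne_of_ne hxy hxz, Equiv.swap_apply_left] at hkv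
    have hcomm : Equiv.swap a b * Equiv.swap y z = Equiv.swap y z * Equiv.swap a b := by
      ext t
      simp only [Equiv.Perm.mul_apply, Equiv.swap_apply_def]
      grind
    have h1 : ρ (Equiv.swap a b) (ρ (Equiv.swap y z) (w x y)) =
        ρ (Equiv.swap y z) (ρ (Equiv.swap a b) (w x y)) := by
      have := congrArg (fun g => ρ g (w x y)) hcomm
      simpa only [map_mul, LinearEquiv.mul_apply] using this
    rw [h, map_smul, hkv, map_smul, smul_comm e k] at h1
    exact (smul_right_injective W hk) h1
  have sy : ∀ x y, ρ (Equiv.swap a b) (w x y) = e • w x y →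
      ρ (Equiv.swap a b) (w y x) = e • w y x := by
    intro x y h
    rw [hsym y x]; exact h
  have all : ∀ x y, x ≠ y → x ≠ a → x ≠ b → y ≠ a → y ≠ b →
      ρ (Equiv.swap a b) (w x y) = e • w x y := by
    intro x y hxy hxa hxb hya hyb
    by_cases hx : x = d
    · subst hx
      by_cases hy : y = c
      · subst hy
        exact sy _ _ hev
      · exact step x c y hcd.symm hxy hac.symm hbc.symm hya hyb (sy _ _ hev)
    · exact step x d y hx hxy had.symm hbd.symm hya hyb
        (sy _ _ (step d c x hcd.symm (Ne.symm hx) hac.symm hbc.symm hxa hxb (sy _ _ hev)))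
  refine ⟨e⁻¹ • (ρ (Equiv.swap a b)).toLinearMap, ?_, ?_⟩
  · intro x y hxy hxa hxb hya hyb
    rw [LinearMap.smul_apply, LinearEquiv.coe_coe, all x y hxy hxa hxb hya hyb,
      inv_smul_smul₀ he]
  · intro x y hxy
    obtain ⟨k, hk, hkv⟩ := hequiv (Equiv.swap a b) x y hxy
    refine ⟨e⁻¹ * k, ?_⟩
    rw [LinearMap.smul_apply, LinearEquiv.coe_coe, hkv, smul_smul]

/-- Four-cycle vectors do not vanish. -/
lemma four_ne (hn : 2 ≤ n) (w : Fin (n + 3) → Fin (n + 3) → W)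
    (hsym : ∀ i j, w i j = w j i)
    (hindep : ∀ i : Fin (n + 3), ∀ s : Finset (Fin (n + 3)), i ∉ s → s.card = n + 1 →
      LinearIndependent ℂ (fun j : s => w i j.1))
    (hint : ∀ i j, i ≠ j → Pspace n w i ⊓ Pspace n w j = Submodule.span ℂ {w i j})
    (a b c d : Fin (n + 3)) (hab : a ≠ b) (hac : a ≠ c) (had : a ≠ d) (hbc : b ≠ c)
    (hbd : b ≠ d) (hcd : c ≠ d) (k l m : ℂ) :
    w b d - k • w a d - (l • w b c - m • w a c) ≠ 0 := by
  intro h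
  have hmem : ∀ i j, i ≠ j → w i j ∈ Pspace n w i := fun i j hij =>
    Submodule.subset_span ⟨j, hij.symm, rfl⟩
  have heq : w b d - l • w b c = k • w a d - m • w a c := by
    rw [← sub_eq_zero, ← h]; abel
  have hB : w b d - l • w b c ∈ Pspace n w a ⊓ Pspace n w b := by
    refine ⟨?_, ?_⟩
    · rw [heq]
      exact Submodule.sub_mem _ (Submodule.smul_mem _ _ (hmem _ _ had))
        (Submodule.smul_mem _ _ (hmem _ _ hac))
    · exact Submodule.sub_mem _ (hmem _ _ hbd) (Submodule.smul_mem _ _ (hmem _ _ hbc))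
  rw [hint a b hab, Submodule.mem_span_singleton] at hB
  obtain ⟨q, hq⟩ := hB
  obtain ⟨s, hs1, hs2, hs3⟩ := Finset.exists_subsuperset_card_eq
    (s := ({a, c, d} : Finset (Fin (n + 3)))) (t := Finset.univ.erase b) (n := n + 1)
    (by intro x; simp; grind)
    (by
      have : ({a, c, d} : Finset (Fin (n + 3))).card ≤ 3 := Finset.card_le_three
      omega)
    (by rw [Finset.card_erase_of_mem (Finset.mem_univ _)]; simp)
  have hbs : b ∉ s := fun hb => by simpa using hs2 hb
  have hli := hindep b s hbs hs3
  have has : a ∈ s := hs1 (by simp)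
  have hcs : c ∈ s := hs1 (by simp)
  have hds : d ∈ s := hs1 (by simp)
  have hnot := hli.notMem_span_image (s := {⟨a, has⟩, ⟨c, hcs⟩}) (x := ⟨d, hds⟩)
    (by simp [had.symm, hcd.symm])
  apply hnot
  rw [Set.image_pair, Submodule.mem_span_pair]
  refine ⟨q, l, ?_⟩
  show q • w b a + l • w b c = w b d
  rw [hsym b a, hq]; abel

lemma key (hn : 2 ≤ n) (w : Fin (n + 3) → Fin (n + 3) → W)
    (hsym : ∀ i j, w i j = w j i)
    (hindep : ∀ i : Fin (n + 3), ∀ s : Finset (Fin (n + 3)), i ∉ s → s.card = n + 1 →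
      LinearIndependent ℂ (fun j : s => w i j.1))
    (hint : ∀ i j, i ≠ j → Pspace n w i ⊓ Pspace n w j = Submodule.span ℂ {w i j})
    (ρ : Equiv.Perm (Fin (n + 3)) →* (W ≃ₗ[ℂ] W))
    (hequiv : ∀ σ i j, i ≠ j → ∃ c : ℂ, c ≠ 0 ∧ ρ σ (w i j) = c • w (σ i) (σ j))
    (r : Fin (n + 3) → Fin (n + 3) → ℂ) (rsym : ∀ i j, r i j = r j i)
    (rdiag : ∀ i, r i i = 0)
    (hr : ∑ p : Fin (n + 3) × Fin (n + 3), r p.1 p.2 • w p.1 p.2 = 0)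
    (a b c d : Fin (n + 3)) (hab : a ≠ b) (hac : a ≠ c) (had : a ≠ d) (hbc : b ≠ c)
    (hbd : b ≠ d) (hcd : c ≠ d) (h1 : r a c = 0) (h2 : r a d = 0) (h3 : r b c = 0) :
    r b d = 0 := by
  obtain ⟨T, hT, hT'⟩ := exists_transp w hsym ρ hequiv a b c d hac had hbc hbd hcd
  obtain ⟨S, hS, hS'⟩ := exists_transp w hsym ρ hequiv c d a b hac.symm hbc.symm
    had.symm hbd.symm hab
  let L : W →ₗ[ℂ] W := (LinearMap.id - S) ∘ₗ (LinearMap.id - T)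
  have hL : ∀ v, L v = v - T v - (S v - S (T v)) := by intro v; simp [L]
  have k1 : ∀ x y, x ≠ y → x ≠ a → x ≠ b → y ≠ a → y ≠ b → L (w x y) = 0 := by
    intro x y hxy hxa hxb hya hyb
    rw [hL, hT x y hxy hxa hxb hya hyb]; simp
  have k2 : ∀ x y, x ≠ y → x ≠ c → x ≠ d → y ≠ c → y ≠ d → L (w x y) = 0 := by
    intro x y hxy hxc hxd hyc hyd
    obtain ⟨k, hk⟩ := hT' x y hxy
    have hz : ∀ z : Fin (n + 3), z ≠ c → z ≠ d →
        Equiv.swap a b z ≠ c ∧ Equiv.swap a b z ≠ d := by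
      intro z hzc hzd
      rw [Equiv.swap_apply_def]
      grind
    have hST : S (T (w x y)) = T (w x y) := by
      rw [hk, map_smul, hS _ _ (by simpa using hxy) (hz x hxc hxd).1 (hz x hxc hxd).2
        (hz y hyc hyd).1 (hz y hyc hyd).2]
    rw [hL, hST, hS x y hxy hxc hxd hyc hyd]; simp
  have k3 : L (w b d) ≠ 0 := by
    obtain ⟨k, hk⟩ := hT' b d hbd
    rw [Equiv.swap_apply_right, Equiv.swap_apply_of_ne_of_ne had.symm hbd.symm] at hk
    obtain ⟨l, hl⟩ := hS' b d hbd
    rw [Equiv.swap_apply_right, Equiv.swap_apply_of_ne_of_ne hbc hbd] at hl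
    obtain ⟨m, hm⟩ := hS' a d had
    rw [Equiv.swap_apply_right, Equiv.swap_apply_of_ne_of_ne hac had] at hm
    rw [hL, hk, map_smul, hl, hm, smul_smul]
    exact four_ne hn w hsym hindep hint a b c d hab hac had hbc hbd hcd _ _ _
  have hsum := congrArg L hr
  rw [map_sum, map_zero, Finset.sum_eq_add (b, d) (d, b)] at hsum
  · simp only [map_smul] at hsum
    rw [hsym d b, rsym d b, ← add_smul, smul_eq_zero] at hsum
    rcases hsum with h | h
    · linear_combination h / 2
    · exact absurd h k3
  · intro h
    exact hbd (congrArg Prod.fst h)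
  · rintro ⟨x, y⟩ - ⟨hp, hq⟩
    have hp' : ¬ (x = b ∧ y = d) := by simpa using hp
    have hq' : ¬ (x = d ∧ y = b) := by simpa using hq
    show L (r x y • w x y) = 0
    rw [map_smul]
    by_cases hxy : x = y
    · subst hxy; rw [rdiag, zero_smul]
    by_cases hA : x ≠ a ∧ x ≠ b ∧ y ≠ a ∧ y ≠ b
    · rw [k1 x y hxy hA.1 hA.2.1 hA.2.2.1 hA.2.2.2, smul_zero]
    by_cases hB : x ≠ c ∧ x ≠ d ∧ y ≠ c ∧ y ≠ d
    · rw [k2 x y hxy hB.1 hB.2.1 hB.2.2.1 hB.2.2.2, smul_zero]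
    have : r x y = 0 := by grind
    rw [this, zero_smul]
  · intro h; exact absurd (Finset.mem_univ _) h
  · intro h; exact absurd (Finset.mem_univ _) h

/-- The index set of the independent family. -/
def idx (n : ℕ) : Finset (Fin (n + 3) × Fin (n + 3)) :=
  (Finset.univ.filter fun p => 0 < p.1 ∧ p.1 < p.2).erase (1, 2)

lemma idx_card (n : ℕ) : (idx n).card = (n + 1) * (n + 2) / 2 - 1 := by
  unfold idx
  rw [Finset.card_erase_of_mem]
  · congr 1
    have : (Finset.univ.filter fun p : Fin (n + 3) × Fin (n + 3) => 0 < p.1 ∧ p.1 < p.2).card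
        = ∑ j : Fin (n + 3), (Finset.Ioo 0 j).card := by
      rw [Finset.card_filter, Fintype.sum_prod_type_right]
      refine Finset.sum_congr rfl fun j _ => ?_
      rw [← Finset.card_filter]
      congr 1
      ext i
      simp
    rw [this]
    simp only [Fin.card_Ioo]
    rw [Fin.sum_univ_eq_sum_range (fun j => j - (0 : Fin (n + 3)).val - 1) (n + 3),
      Finset.sum_range_succ']
    simp [Finset.sum_range_id]
    rw [mul_comm]
  · have h1 : (1 : Fin (n + 3)).val = 1 := Fin.val_one _
    have h2 : (2 : Fin (n + 3)).val = 2 := Fin.val_two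
    rw [Finset.mem_filter]
    refine ⟨Finset.mem_univ _, ?_, ?_⟩
    · show (0 : Fin (n + 3)).val < (1 : Fin (n + 3)).val
      rw [h1]; exact Nat.zero_lt_one
    · show (1 : Fin (n + 3)).val < (2 : Fin (n + 3)).val
      rw [h1, h2]; exact Nat.one_lt_two

end Helpers

/-- Lemma TECH of the paper, in linear terms: given nonzero vectors
`w_{ij} = w_{ji}` (`1 ≤ i < j ≤ n+3`) in a complex vector space `W` satisfying
(H1) each `P_i = ⟨w_{ij} : j ≠ i⟩` has dimension `n+1` and any `n+1` of the `w_{ij}` (`j ≠ i`)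
are linearly independent; (H2) `P_i ∩ P_j = ⟨w_{ij}⟩` for `i ≠ j`; (H3) there is a linear
action `ρ` of the symmetric group with `ρ(σ)(w_{ij})` a nonzero multiple of `w_{σ(i)σ(j)}`,
such that for each `i` the only subspaces of `P_i` invariant under all `ρ(σ)` with `σ i = i`
are `0` and `P_i`;  then the span of all the `w_{ij}` has dimension at least
`(n+1)(n+2)/2 − 1`. -/
theorem stmt15 (n : ℕ) (hn : 2 ≤ n) (W : Type*) [AddCommGroup W] [Module ℂ W]
    (w : Fin (n + 3) → Fin (n + 3) → W)
    (hsym : ∀ i j, w i j = w j i)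
    (hnz : ∀ i j, i ≠ j → w i j ≠ 0)
    (hdim : ∀ i, Module.finrank ℂ ↥(Pspace n w i) = n + 1)
    (hindep : ∀ i : Fin (n + 3), ∀ s : Finset (Fin (n + 3)), i ∉ s → s.card = n + 1 →
      LinearIndependent ℂ (fun j : s => w i j.1))
    (hint : ∀ i j, i ≠ j → Pspace n w i ⊓ Pspace n w j = Submodule.span ℂ {w i j})
    (ρ : Equiv.Perm (Fin (n + 3)) →* (W ≃ₗ[ℂ] W))
    (hequiv : ∀ σ i j, i ≠ j → ∃ c : ℂ, c ≠ 0 ∧ ρ σ (w i j) = c • w (σ i) (σ j))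
    (hirr : ∀ i : Fin (n + 3), ∀ U : Submodule ℂ W, U ≤ Pspace n w i →
      (∀ σ : Equiv.Perm (Fin (n + 3)), σ i = i → ∀ x ∈ U, ρ σ x ∈ U) →
      U = ⊥ ∨ U = Pspace n w i) :
    (n + 1) * (n + 2) / 2 - 1 ≤
      Module.finrank ℂ ↥(Submodule.span ℂ {x : W | ∃ i j, i ≠ j ∧ x = w i j}) := by
  classical
  have hv1 : (1 : Fin (n + 3)).val = 1 := Fin.val_one _
  have hv2 : (2 : Fin (n + 3)).val = 2 := Fin.val_two
  have hmem : ∀ i j : Fin (n + 3), (i, j) ∈ idx n ↔ ¬ (i = 1 ∧ j = 2) ∧ 0 < i ∧ i < j := by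
    intro i j; simp [idx]
  have hli : LinearIndependent ℂ (fun p : idx n => w p.1.1 p.1.2) := by
    rw [Fintype.linearIndependent_iff]
    intro g hg
    let g' : Fin (n + 3) × Fin (n + 3) → ℂ := fun p => if h : p ∈ idx n then g ⟨p, h⟩ else 0
    have hg0 : ∀ p, p ∉ idx n → g' p = 0 := fun p hp => dif_neg hp
    have hg1 : ∑ p : Fin (n + 3) × Fin (n + 3), g' p • w p.1 p.2 = 0 := by
      rw [← Finset.sum_subset (Finset.subset_univ (idx n))
        (fun p _ hp => by rw [hg0 p hp, zero_smul]), ← Finset.sum_coe_sort, ← hg]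
      refine Finset.sum_congr rfl fun p _ => ?_
      simp [g']
    let r : Fin (n + 3) → Fin (n + 3) → ℂ := fun i j => g' (i, j) + g' (j, i)
    have rsym : ∀ i j, r i j = r j i := fun i j => add_comm _ _
    have rdiag : ∀ i, r i i = 0 := by
      intro i
      have : (i, i) ∉ idx n := by rw [hmem]; simp
      simp only [r, hg0 _ this, add_zero]
    have hr : ∑ p : Fin (n + 3) × Fin (n + 3), r p.1 p.2 • w p.1 p.2 = 0 := by
      simp only [r, add_smul, Finset.sum_add_distrib]
      rw [hg1, zero_add, ← hg1]
      refine Fintype.sum_equiv (Equiv.prodComm _ _) _ _ fun p => ?_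
      simp [hsym p.1 p.2, Prod.swap]
    have K := key hn w hsym hindep hint ρ hequiv r rsym rdiag hr
    have r0 : ∀ j, r 0 j = 0 := by
      intro j
      have e1 : (0, j) ∉ idx n := by rw [hmem]; simp
      have e2 : (j, 0) ∉ idx n := by rw [hmem]; simp
      simp only [r, hg0 _ e1, hg0 _ e2, add_zero]
    have r12 : r 1 2 = 0 := by
      have e1 : ((1 : Fin (n + 3)), (2 : Fin (n + 3))) ∉ idx n := by rw [hmem]; simp
      have e2 : ((2 : Fin (n + 3)), (1 : Fin (n + 3))) ∉ idx n := by
        rw [hmem, Fin.lt_def, Fin.lt_def, hv1, hv2]; simp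
      simp only [r, hg0 _ e1, hg0 _ e2, add_zero]
    have n01 : (0 : Fin (n + 3)) ≠ 1 := by intro h; simp [Fin.ext_iff] at h
    have n02 : (0 : Fin (n + 3)) ≠ 2 := by
      intro h; rw [Fin.ext_iff, hv2] at h; simp at h
    have n12 : (1 : Fin (n + 3)) ≠ 2 := by
      intro h; rw [Fin.ext_iff, hv2, hv1] at h; simp at h
    have r1 : ∀ j, r 1 j = 0 := by
      intro j
      by_cases j0 : j = 0
      · rw [j0, rsym, r0]
      by_cases j1 : j = 1
      · rw [j1, rdiag]
      by_cases j2 : j = 2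
      · rw [j2, r12]
      exact K 0 1 2 j n01 n02 (Ne.symm j0) n12 (Ne.symm j1) (Ne.symm j2) (r0 _) (r0 _) r12
    have rall : ∀ i j, r i j = 0 := by
      intro i j
      by_cases j0 : j = 0
      · rw [j0, rsym, r0]
      by_cases j1 : j = 1
      · rw [j1, rsym, r1]
      by_cases i0 : i = 0
      · rw [i0, r0]
      by_cases i1 : i = 1
      · rw [i1, r1]
      by_cases hij : i = j
      · rw [hij, rdiag]
      exact K 0 i 1 j (Ne.symm i0) n01 (Ne.symm j0) i1 hij (Ne.symm j1) (r0 _) (r0 _)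
        (by rw [rsym, r1])
    rintro ⟨⟨i, j⟩, hp⟩
    have hlt := ((hmem i j).1 hp).2.2
    have e2 : (j, i) ∉ idx n := by
      rw [hmem]; intro h; exact absurd h.2.2 (not_lt.2 hlt.le)
    have := rall i j
    simp only [r, hg0 _ e2, add_zero, g', dif_pos hp] at this
    exact this
  have hcard := finrank_span_eq_card hli
  rw [Fintype.card_coe, idx_card] at hcard
  rw [← hcard]
  have hfin : ({x : W | ∃ i j, i ≠ j ∧ x = w i j}).Finite := by
    refine (Set.finite_range fun p : Fin (n + 3) × Fin (n + 3) => w p.1 p.2).subset ?_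
    rintro x ⟨i, j, -, rfl⟩
    exact ⟨(i, j), rfl⟩
  haveI := FiniteDimensional.span_of_finite ℂ hfin
  apply Submodule.finrank_mono
  apply Submodule.span_mono
  rintro x ⟨⟨⟨i, j⟩, hp⟩, rfl⟩
  exact ⟨i, j, ((hmem i j).1 hp).2.2.ne, rfl⟩
end

section
/- Let n ≥ 2 be an integer. In the variables x2,…,xn, set x_{n+1} = 0 and x_{n+2} = 1, and define the rational functions F0(x2,…,xn) = 1/(x2·x3·…·xn) and, for each pair (i,j) with 2 ≤ i ≤ n and i < j ≤ n+2, F_{ij}(x2,…,xn) = (xi − xj)^{n−1} · ( Π (xp − xq) over pairs p < q with p, q ∈ {2,…,n+2} \ {i,j} ) / ( Π_{2 ≤ p < q ≤ n+2} (xp − xq) ). Then the family consisting of the (n−1)(n+2)/2 functions F_{ij} when n is even, respectively of these functions together with F0 when n is odd, is linearly independent over ℂ (as rational functions in x2,…,xn). -/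
/-- The extension of a tuple `(x₂,…,xₙ)` of complex numbers by `x_{n+1} = 0` and
`x_{n+2} = 1`. -/
noncomputable def XextC (n : ℕ) (v : Fin (n - 1) → ℂ) (t : ℕ) : ℂ :=
  if t = n + 1 then 0
  else if t = n + 2 then 1
  else if h2 : 2 ≤ t then if h3 : t ≤ n then v ⟨t - 2, by omega⟩ else 0
  else 0

/-- `∏_{p<q ∈ S} (X p − X q)`. -/
noncomputable def pairProdC (S : Finset ℕ) (X : ℕ → ℂ) : ℂ :=
  ∏ p ∈ S, ∏ q ∈ S, if p < q then X p - X q else 1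

/-- `F₀(x₂,…,xₙ) = 1/(x₂⋯xₙ)`. -/
noncomputable def Fzero (n : ℕ) : (Fin (n - 1) → ℂ) → ℂ := fun v => 1 / ∏ i, v i

/-- `F_{ij}(x₂,…,xₙ) = (xᵢ−xⱼ)^{n−1} · (Π_{p<q ∈ {2,…,n+2}∖{i,j}} (x_p−x_q)) /
(Π_{2≤p<q≤n+2} (x_p−x_q))`, with `x_{n+1} = 0` and `x_{n+2} = 1`. -/
noncomputable def Fpair (n i j : ℕ) : (Fin (n - 1) → ℂ) → ℂ := fun v =>
  (XextC n v i - XextC n v j) ^ (n - 1) *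
    pairProdC (((Finset.Icc 2 (n + 2)).erase i).erase j) (XextC n v) /
    pairProdC (Finset.Icc 2 (n + 2)) (XextC n v)

/-- The pole-free domain: all entries `∉ {0,1}` and pairwise distinct.  (Linear independence
of the restrictions to this Zariski-dense domain is equivalent to linear independence as
rational functions.) -/
def ratOmega (n : ℕ) : Set (Fin (n - 1) → ℂ) :=
  {v | (∀ i, v i ≠ 0 ∧ v i ≠ 1) ∧ ∀ i j, i ≠ j → v i ≠ v j}


section auxSec

open Finset Filter Topology

/-- symmetric form of the pair functions -/
noncomputable def auxG (S : Finset ℕ) (i j : ℕ) (X : ℕ → ℂ) : ℂ :=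
  (X i - X j)⁻¹ * ∏ m ∈ (S.erase i).erase j, ((X i - X j) / ((X i - X m) * (X j - X m)))

noncomputable def auxK (S : Finset ℕ) (a : ℕ) (X : ℕ → ℂ) : ℂ :=
  ∏ m ∈ S.erase a, (X a - X m)⁻¹

lemma lim_inv (x : ℂ) : Tendsto (fun N : ℕ => ((N : ℂ) - x)⁻¹) atTop (𝓝 0) := by
  apply Filter.Tendsto.comp tendsto_inv₀_cobounded
  rw [← tendsto_norm_atTop_iff_cobounded]
  refine tendsto_atTop_mono (fun N : ℕ => ?_)
    (tendsto_atTop_add_const_right atTop (-‖x‖) (tendsto_natCast_atTop_atTop (R := ℝ)))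
  have := norm_sub_norm_le (N : ℂ) x
  simp at this
  linarith

lemma ev_ne (x : ℂ) : ∀ᶠ N : ℕ in atTop, (N : ℂ) ≠ x := by
  by_cases h : ∃ M : ℕ, (M : ℂ) = x
  · obtain ⟨M, rfl⟩ := h
    filter_upwards [eventually_gt_atTop M] with N hN
    exact_mod_cast hN.ne'
  · exact Eventually.of_forall fun N hN => h ⟨N, hN⟩

lemma lim_ratio (x y : ℂ) :
    Tendsto (fun N : ℕ => ((N : ℂ) - x) / ((N : ℂ) - y)) atTop (𝓝 1) := by
  have h := ((lim_inv y).const_mul (y - x)).const_add 1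
  simp only [mul_zero, add_zero] at h
  refine h.congr' ?_
  filter_upwards [ev_ne y] with N hN
  have : (N : ℂ) - y ≠ 0 := sub_ne_zero.2 hN
  field_simp
  ring

lemma lim_ratio0 (y : ℂ) :
    Tendsto (fun N : ℕ => (N : ℂ) * ((N : ℂ) - y)⁻¹) atTop (𝓝 1) := by
  simpa [div_eq_mul_inv] using lim_ratio 0 y

lemma lim_ratio0' (y : ℂ) :
    Tendsto (fun N : ℕ => (N : ℂ) * (y - (N : ℂ))⁻¹) atTop (𝓝 (-1)) := by
  have := (lim_ratio0 y).neg
  refine this.congr fun N => ?_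
  rw [← neg_sub (N : ℂ) y, inv_neg]; ring

lemma ev_inj (S : Finset ℕ) (k : ℕ) (X : ℕ → ℂ) (hX : Set.InjOn X (S.erase k)) :
    ∀ᶠ N : ℕ in atTop, Set.InjOn (Function.update X k (N : ℂ)) S := by
  have : ∀ᶠ N : ℕ in atTop, ∀ m ∈ S, (N : ℂ) ≠ X m :=
    (Finset.eventually_all S).2 fun m _ => ev_ne _
  filter_upwards [this] with N hN
  intro p hp q hq h
  by_cases h1 : p = k <;> by_cases h2 : q = k
  · rw [h1, h2]
  · subst h1; rw [Function.update_self, Function.update_of_ne h2] at h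
    exact absurd h (hN q hq)
  · subst h2; rw [Function.update_self, Function.update_of_ne h1] at h
    exact absurd h.symm (hN p hp)
  · rw [Function.update_of_ne h1, Function.update_of_ne h2] at h
    exact hX (by simpa [h1] using hp) (by simpa [h2] using hq) h

lemma auxK_lim_ne (S : Finset ℕ) (a k : ℕ) (hk : k ∈ S) (hak : a ≠ k) (X : ℕ → ℂ) :
    Tendsto (fun N : ℕ => (N : ℂ) * auxK S a (Function.update X k (N : ℂ))) atTop
      (𝓝 (-auxK (S.erase k) a X)) := by
  have h := (lim_ratio0' (X a)).mul_const (auxK (S.erase k) a X)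
  rw [neg_one_mul] at h
  refine h.congr fun N => ?_
  unfold auxK
  rw [← Finset.mul_prod_erase (S.erase a) _ (show k ∈ S.erase a by simp [hk, hak.symm]),
    Finset.erase_right_comm, Function.update_self, Function.update_of_ne hak, mul_assoc]
  congr 2
  refine Finset.prod_congr rfl fun m hm => ?_
  rw [Function.update_of_ne (by simp at hm; tauto)]

lemma auxK_lim_eq (S : Finset ℕ) (k : ℕ) (hk : k ∈ S) (hS : 3 ≤ #S) (X : ℕ → ℂ) :
    Tendsto (fun N : ℕ => (N : ℂ) * auxK S k (Function.update X k (N : ℂ))) atTop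
      (𝓝 0) := by
  have hc : 2 ≤ #(S.erase k) := by rw [card_erase_of_mem hk]; omega
  obtain ⟨p, hp⟩ : (S.erase k).Nonempty := card_pos.1 (by omega)
  have hc2 : 1 ≤ #((S.erase k).erase p) := by rw [card_erase_of_mem hp]; omega
  have h1 : Tendsto (fun N : ℕ => ∏ m ∈ (S.erase k).erase p, ((N : ℂ) - X m)⁻¹) atTop
      (𝓝 (∏ m ∈ (S.erase k).erase p, (0 : ℂ))) :=
    tendsto_finsetProd _ fun m _ => lim_inv _
  rw [prod_const, zero_pow (by omega)] at h1
  have h := (lim_ratio0 (X p)).mul h1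
  rw [mul_zero] at h
  refine h.congr fun N => ?_
  unfold auxK
  rw [← Finset.mul_prod_erase (S.erase k) _ hp, Function.update_self,
    Function.update_of_ne (by simp at hp; tauto), mul_assoc]
  congr 2
  refine Finset.prod_congr rfl fun m hm => ?_
  rw [Function.update_of_ne (by simp at hm; tauto)]

lemma auxG_lim_left (S : Finset ℕ) (k l : ℕ) (hlk : l ≠ k) (X : ℕ → ℂ) :
    Tendsto (fun N : ℕ => (N : ℂ) * auxG S k l (Function.update X k (N : ℂ))) atTop
      (𝓝 (auxK (S.erase k) l X)) := by
  have h1 : Tendsto (fun N : ℕ => ∏ m ∈ (S.erase k).erase l,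
      (((N : ℂ) - X l) / ((N : ℂ) - X m) * (X l - X m)⁻¹)) atTop
      (𝓝 (∏ m ∈ (S.erase k).erase l, (1 * (X l - X m)⁻¹))) :=
    tendsto_finsetProd _ fun m _ => (lim_ratio _ _).mul_const _
  have h := (lim_ratio0 (X l)).mul h1
  simp only [one_mul] at h
  refine h.congr fun N => ?_
  unfold auxG
  rw [Function.update_self, Function.update_of_ne hlk, mul_assoc]
  congr 2
  refine Finset.prod_congr rfl fun m hm => ?_
  rw [Function.update_of_ne (by simp at hm; tauto), div_mul_eq_div_div, div_eq_mul_inv (_ / _)]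

lemma auxG_swap (S : Finset ℕ) (i j : ℕ) (hi : i ∈ S) (hj : j ∈ S) (hij : i ≠ j) (X : ℕ → ℂ) :
    auxG S i j X = (-1) ^ (#S - 1) * auxG S j i X := by
  have hc : #S - 1 = 1 + #((S.erase j).erase i) := by
    rw [card_erase_of_mem (by simp [hi, hij]), card_erase_of_mem hj]
    have : 2 ≤ #S := by
      have := Finset.card_le_card (show ({i, j} : Finset ℕ) ⊆ S by
        intro x; simp; rintro (rfl | rfl) <;> assumption)
      rwa [card_pair hij] at this
    omega
  unfold auxG
  rw [hc, pow_add, pow_one, Finset.erase_right_comm, ← neg_sub (X j) (X i), inv_neg,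
    ← Finset.prod_const]
  have : ∏ m ∈ (S.erase j).erase i, -(X j - X i) / ((X i - X m) * (X j - X m))
    = (∏ m ∈ (S.erase j).erase i, (-1 : ℂ)) *
      ∏ m ∈ (S.erase j).erase i, (X j - X i) / ((X j - X m) * (X i - X m)) := by
    rw [← Finset.prod_mul_distrib]
    refine prod_congr rfl fun m _ => ?_
    rw [mul_comm (X i - X m)]; ring
  rw [this]; ring

lemma auxG_lim_right (S : Finset ℕ) (k l : ℕ) (hk : k ∈ S) (hl : l ∈ S) (hlk : l ≠ k)
    (X : ℕ → ℂ) :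
    Tendsto (fun N : ℕ => (N : ℂ) * auxG S l k (Function.update X k (N : ℂ))) atTop
      (𝓝 ((-1) ^ (#S - 1) * auxK (S.erase k) l X)) := by
  refine ((auxG_lim_left S k l hlk X).const_mul ((-1) ^ (#S - 1))).congr fun N => ?_
  rw [auxG_swap S l k hl hk hlk]; ring

lemma auxG_lim_zero (S : Finset ℕ) (k i j : ℕ) (hk : k ∈ S) (hik : i ≠ k) (hjk : j ≠ k)
    (X : ℕ → ℂ) :
    Tendsto (fun N : ℕ => (N : ℂ) * auxG S i j (Function.update X k (N : ℂ))) atTop (𝓝 0) := by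
  have h := (((lim_ratio0 (X i)).mul (lim_inv (X j))).mul_const
    ((X i - X j) * (X i - X j)⁻¹ * ∏ m ∈ ((S.erase i).erase j).erase k,
      ((X i - X j) / ((X i - X m) * (X j - X m)))))
  simp only [mul_zero, zero_mul] at h
  refine h.congr fun N => ?_
  unfold auxG
  rw [← Finset.mul_prod_erase ((S.erase i).erase j) _
    (show k ∈ (S.erase i).erase j by simp [hk, hik.symm, hjk.symm])]
  rw [Function.update_self, Function.update_of_ne hik, Function.update_of_ne hjk]
  have : ∏ m ∈ ((S.erase i).erase j).erase k, (X i - X j) /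
      ((X i - Function.update X k (N : ℂ) m) * (X j - Function.update X k (N : ℂ) m)) =
      ∏ m ∈ ((S.erase i).erase j).erase k, (X i - X j) / ((X i - X m) * (X j - X m)) := by
    refine Finset.prod_congr rfl fun m hm => ?_
    rw [Function.update_of_ne (by simp at hm; tauto)]
  rw [this, show (X i - (N : ℂ)) * (X j - (N : ℂ)) = ((N : ℂ) - X i) * ((N : ℂ) - X j) by ring,
    div_eq_mul_inv (X i - X j) (((N : ℂ) - X i) * ((N : ℂ) - X j)), mul_inv]
  ring

lemma lagr_step (T : Finset ℕ) (hT : 3 ≤ #T) (e : ℕ → ℂ) (k : ℕ) (hk : k ∈ T)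
    (H : ∀ X : ℕ → ℂ, Set.InjOn X T → ∑ l ∈ T, e l * auxK T l X = 0)
    (X : ℕ → ℂ) (hX : Set.InjOn X (T.erase k)) :
    ∑ l ∈ T.erase k, e l * auxK (T.erase k) l X = 0 := by
  have h1 : Tendsto (fun N : ℕ => ∑ l ∈ T,
      e l * ((N : ℂ) * auxK T l (Function.update X k (N : ℂ)))) atTop
      (𝓝 (∑ l ∈ T, e l * (if l = k then 0 else -auxK (T.erase k) l X))) := by
    refine tendsto_finsetSum _ fun l hl => Tendsto.const_mul _ ?_
    split_ifs with h
    · subst h; exact auxK_lim_eq T l hl hT X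
    · exact auxK_lim_ne T l k hk h X
  have h2 : Tendsto (fun N : ℕ => ∑ l ∈ T,
      e l * ((N : ℂ) * auxK T l (Function.update X k (N : ℂ)))) atTop (𝓝 0) := by
    refine tendsto_const_nhds.congr' ?_
    filter_upwards [ev_inj T k X hX] with N hN
    have := H _ hN
    rw [← mul_zero (N : ℂ), ← this, mul_sum]
    exact sum_congr rfl fun l _ => by ring
  have h3 := tendsto_nhds_unique h1 h2
  rw [← Finset.add_sum_erase T _ hk] at h3
  simp only [if_true, mul_zero, zero_add] at h3
  rw [← neg_eq_zero, ← h3, ← sum_neg_distrib]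
  refine sum_congr rfl fun l hl => ?_
  rw [if_neg (by simp at hl; tauto)]; ring

lemma lagr (n : ℕ) : ∀ (T : Finset ℕ), #T = n → ∀ (e : ℕ → ℂ),
    (∀ X : ℕ → ℂ, Set.InjOn X T → ∑ l ∈ T, e l * auxK T l X = 0) →
    ∀ i ∈ T, ∀ j ∈ T, e i = e j := by
  induction n with
  | zero => intro T hT e _ i hi; simp at hT; simp [hT] at hi
  | succ n ih =>
    intro T hT e H i hi j hj
    by_cases hij : i = j
    · rw [hij]
    by_cases h3 : 3 ≤ #T
    · obtain ⟨k, hk, hkij⟩ : ∃ k ∈ T, k ∉ ({i, j} : Finset ℕ) := by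
        by_contra! hcon
        have := card_le_card (show T ⊆ {i, j} from hcon)
        rw [card_pair hij] at this; omega
      simp at hkij
      exact ih (T.erase k) (by rw [card_erase_of_mem hk]; omega) e
        (lagr_step T h3 e k hk H) i (by simp [hi]; tauto) j (by simp [hj]; tauto)
    · have hsub : ({i, j} : Finset ℕ) ⊆ T := by
        intro x; simp; rintro (rfl | rfl) <;> assumption
      have hTe : T = {i, j} := (eq_of_subset_of_card_le hsub (by rw [card_pair hij]; omega)).symm
      have := H (fun t => (t : ℂ)) (fun a _ b _ h => by simpa using h)
      subst hTe
      rw [sum_pair hij] at this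
      have e1 : ({i, j} : Finset ℕ).erase i = {j} := by ext x; simp; grind
      have e2 : ({i, j} : Finset ℕ).erase j = {i} := by ext x; simp; grind
      simp only [auxK, e1, e2, prod_singleton] at this
      have hne : (i : ℂ) - j ≠ 0 := sub_ne_zero.2 (by exact_mod_cast hij)
      rw [← neg_sub (i : ℂ) j, inv_neg] at this
      have h4 : (e i - e j) * ((i : ℂ) - j)⁻¹ = 0 := by linear_combination this
      rcases mul_eq_zero.1 h4 with h | h
      · exact sub_eq_zero.1 h
      · exact absurd h (inv_ne_zero hne)

lemma core (S : Finset ℕ) (hS : 3 ≤ #S) (a : ℕ) (ha : a ∈ S) (h : ℕ → ℕ → ℂ) (c : ℂ)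
    (H : ∀ X : ℕ → ℂ, Set.InjOn X S →
      ∑ i ∈ S, ∑ j ∈ S.erase i, h i j * auxG S i j X + c * auxK S a X = 0)
    (k : ℕ) (hk : k ∈ S) (i : ℕ) (hi : i ∈ S) (hik : i ≠ k) (j : ℕ) (hj : j ∈ S) (hjk : j ≠ k) :
    (h k i + (-1) ^ (#S - 1) * h i k - if i = a then c else 0) =
    (h k j + (-1) ^ (#S - 1) * h j k - if j = a then c else 0) := by
  refine lagr _ (S.erase k) rfl
    (fun l => h k l + (-1) ^ (#S - 1) * h l k - if l = a then c else 0) ?_ i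
    (by simp [hi, hik]) j (by simp [hj, hjk])
  intro X hX
  have hA : Tendsto (fun N : ℕ => ∑ i ∈ S, ∑ j ∈ S.erase i,
      h i j * ((N : ℂ) * auxG S i j (Function.update X k (N : ℂ)))) atTop
      (𝓝 (∑ i ∈ S, ∑ j ∈ S.erase i, h i j * (if i = k then auxK (S.erase k) j X else
        if j = k then (-1) ^ (#S - 1) * auxK (S.erase k) i X else 0))) := by
    refine tendsto_finsetSum _ fun p hp => tendsto_finsetSum _ fun q hq =>
      Tendsto.const_mul _ ?_
    simp at hq
    split_ifs with h1 h2
    · subst h1; exact auxG_lim_left S p q hq.1 X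
    · subst h2; exact auxG_lim_right S q p hk hp h1 X
    · exact auxG_lim_zero S k p q hk h1 h2 X
  have hB : Tendsto (fun N : ℕ => c * ((N : ℂ) * auxK S a (Function.update X k (N : ℂ)))) atTop
      (𝓝 (c * if a = k then 0 else -auxK (S.erase k) a X)) := by
    refine Tendsto.const_mul _ ?_
    split_ifs with h1
    · subst h1; exact auxK_lim_eq S a hk hS X
    · exact auxK_lim_ne S a k hk h1 X
  have hC : Tendsto (fun N : ℕ => ∑ i ∈ S, ∑ j ∈ S.erase i,
      h i j * ((N : ℂ) * auxG S i j (Function.update X k (N : ℂ))) +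
      c * ((N : ℂ) * auxK S a (Function.update X k (N : ℂ)))) atTop (𝓝 0) := by
    refine tendsto_const_nhds.congr' ?_
    filter_upwards [ev_inj S k X hX] with N hN
    have := H _ hN
    rw [← mul_zero (N : ℂ), ← this, mul_add, mul_sum]
    congr 1
    · refine sum_congr rfl fun l _ => ?_
      rw [mul_sum]
      exact sum_congr rfl fun l _ => by ring
    · ring
  have hD := tendsto_nhds_unique (hA.add hB) hC
  rw [← Finset.add_sum_erase S _ hk] at hD
  have e1 : ∑ i ∈ S.erase k, ∑ j ∈ S.erase i, h i j * (if i = k then auxK (S.erase k) j X else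
        if j = k then (-1) ^ (#S - 1) * auxK (S.erase k) i X else 0)
      = ∑ i ∈ S.erase k, h i k * ((-1) ^ (#S - 1) * auxK (S.erase k) i X) := by
    refine sum_congr rfl fun p hp => ?_
    have hp' : p ≠ k := by simp at hp; tauto
    rw [sum_eq_single_of_mem k (by simp [hk, hp'.symm])]
    · rw [if_neg hp', if_pos rfl]
    · intro q _ hq; rw [if_neg hp', if_neg hq, mul_zero]
  rw [e1] at hD
  have e2 : ∑ l ∈ S.erase k, (if l = a then c else 0) * auxK (S.erase k) l X =
      -(c * if a = k then 0 else -auxK (S.erase k) a X) := by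
    simp only [ite_mul, zero_mul, sum_ite_eq', mem_erase, ha, and_true]
    split_ifs <;> simp_all
  simp only [if_true] at hD
  simp only [sub_mul, add_mul, sum_sub_distrib, sum_add_distrib, e2]
  have : ∑ i ∈ S.erase k, h i k * ((-1) ^ (#S - 1) * auxK (S.erase k) i X) =
     ∑ i ∈ S.erase k, (-1) ^ (#S - 1) * h i k * auxK (S.erase k) i X :=
    sum_congr rfl fun _ _ => by ring
  rw [this] at hD
  linear_combination hD

/-- sign -/
noncomputable def auxs (p q : ℕ) : ℂ := if p < q then 1 else -1

lemma auxs_ne (p q : ℕ) : auxs p q ≠ 0 := by unfold auxs; split_ifs <;> simp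

lemma pairProd_erase (S : Finset ℕ) (k : ℕ) (hk : k ∈ S) (X : ℕ → ℂ) :
    pairProdC S X = (∏ l ∈ S.erase k, (auxs k l * (X k - X l))) * pairProdC (S.erase k) X := by
  obtain ⟨T, hT, rfl⟩ : ∃ T, k ∉ T ∧ insert k T = S := ⟨S.erase k, by simp, insert_erase hk⟩
  rw [erase_insert hT]
  unfold pairProdC
  rw [prod_insert hT, prod_insert hT]
  simp only [prod_insert hT, prod_mul_distrib, lt_irrefl, if_false, one_mul]
  rw [← mul_assoc]
  congr 1
  rw [← prod_mul_distrib, ← prod_mul_distrib]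
  refine prod_congr rfl fun q hq => ?_
  have : q ≠ k := fun h => hT (h ▸ hq)
  unfold auxs
  rcases lt_or_gt_of_ne this with h | h
  · rw [if_neg (by omega), if_pos h, if_neg (by omega)]; ring
  · rw [if_pos h, if_neg (by omega), if_pos h]; ring

noncomputable def auxsig (S : Finset ℕ) (i j : ℕ) : ℂ :=
  (auxs i j * ∏ l ∈ (S.erase i).erase j, (auxs i l * auxs j l))⁻¹

lemma auxsig_ne (S : Finset ℕ) (i j : ℕ) : auxsig S i j ≠ 0 := by
  unfold auxsig
  exact inv_ne_zero (mul_ne_zero (auxs_ne _ _) (prod_ne_zero_iff.2 fun l _ =>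
    mul_ne_zero (auxs_ne _ _) (auxs_ne _ _)))

lemma pairProd_ne (S : Finset ℕ) (X : ℕ → ℂ) (hX : Set.InjOn X S) : pairProdC S X ≠ 0 := by
  unfold pairProdC
  refine prod_ne_zero_iff.2 fun p hp => prod_ne_zero_iff.2 fun q hq => ?_
  split_ifs with h
  · exact sub_ne_zero.2 fun e => h.ne (hX hp hq e)
  · exact one_ne_zero

lemma F_eq (n : ℕ) (S : Finset ℕ) (hS : #S = n + 1) (i j : ℕ) (hi : i ∈ S) (hj : j ∈ S)
    (hij : i ≠ j) (X : ℕ → ℂ) (hX : Set.InjOn X S) :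
    (X i - X j) ^ (n - 1) * pairProdC ((S.erase i).erase j) X / pairProdC S X =
      auxsig S i j * auxG S i j X := by
  have hji : j ∈ S.erase i := by simp [hj, hij.symm]
  have hc : n - 1 = #((S.erase i).erase j) := by
    rw [card_erase_of_mem hji, card_erase_of_mem hi, hS]; omega
  have hV : pairProdC ((S.erase i).erase j) X ≠ 0 :=
    pairProd_ne _ _ (hX.mono (by intro x; simp; tauto))
  rw [pairProd_erase S i hi, pairProd_erase (S.erase i) j hji,
    ← mul_prod_erase (S.erase i) (fun l => auxs i l * (X i - X l)) hji, hc,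
    ← prod_const (s := (S.erase i).erase j) (X i - X j), auxsig, auxG]
  have h1 : (∏ m ∈ (S.erase i).erase j, ((X i - X j) / ((X i - X m) * (X j - X m)))) =
    (∏ m ∈ (S.erase i).erase j, (X i - X j)) * ((∏ m ∈ (S.erase i).erase j, (X i - X m)) *
      (∏ m ∈ (S.erase i).erase j, (X j - X m)))⁻¹ := by
    rw [prod_div_distrib, prod_mul_distrib, div_eq_mul_inv]
  rw [h1]
  simp only [prod_mul_distrib, mul_inv, div_eq_mul_inv]
  have := mul_inv_cancel₀ hV
  generalize (pairProdC ((S.erase i).erase j) X)⁻¹ = W at *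
  generalize pairProdC ((S.erase i).erase j) X = V at *
  generalize (∏ m ∈ (S.erase i).erase j, (X i - X j)) = A at *
  linear_combination (A * (auxs i j)⁻¹ * (X i - X j)⁻¹ * (∏ x ∈ (S.erase i).erase j, auxs i x)⁻¹ *
    (∏ x ∈ (S.erase i).erase j, auxs j x)⁻¹ * (∏ x ∈ (S.erase i).erase j, (X i - X x))⁻¹ *
    (∏ x ∈ (S.erase i).erase j, (X j - X x))⁻¹) * this

lemma auxG_scale (n : ℕ) (S : Finset ℕ) (hS : #S = n + 1) (i j : ℕ) (hi : i ∈ S) (hj : j ∈ S)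
    (hij : i ≠ j) (X Y : ℕ → ℂ) (β δ : ℂ) (hδ : δ ≠ 0) (hY : ∀ t ∈ S, Y t = (X t - β) / δ) :
    auxG S i j Y = δ ^ n * auxG S i j X := by
  have hji : j ∈ S.erase i := by simp [hj, hij.symm]
  have hc : n = 1 + #((S.erase i).erase j) := by
    have : 0 < #(S.erase i) := card_pos.2 ⟨j, hji⟩
    rw [card_erase_of_mem hi] at this
    rw [card_erase_of_mem hji, card_erase_of_mem hi, hS]; omega
  have key : ∀ p ∈ S, ∀ q ∈ S, Y p - Y q = (X p - X q) * δ⁻¹ := by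
    intro p hp q hq
    rw [hY p hp, hY q hq]; ring
  rw [hc, pow_add, pow_one, ← prod_const]
  unfold auxG
  rw [key i hi j hj, mul_inv, inv_inv]
  have : ∏ m ∈ (S.erase i).erase j, (X i - X j) * δ⁻¹ / ((Y i - Y m) * (Y j - Y m)) =
      (∏ m ∈ (S.erase i).erase j, δ) *
      ∏ m ∈ (S.erase i).erase j, (X i - X j) / ((X i - X m) * (X j - X m)) := by
    rw [← prod_mul_distrib]
    refine prod_congr rfl fun m hm => ?_
    have hm' : m ∈ S := by simp at hm; tauto
    rw [key i hi m hm', key j hj m hm']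
    simp only [div_eq_mul_inv, mul_inv, inv_inv]
    have := mul_inv_cancel₀ hδ
    linear_combination ((X i - X j) * (X i - X m)⁻¹ * (X j - X m)⁻¹ * δ) * this
  rw [this]; ring

lemma auxK_scale (n : ℕ) (S : Finset ℕ) (hS : #S = n + 1) (a : ℕ) (ha : a ∈ S)
    (X Y : ℕ → ℂ) (β δ : ℂ) (hY : ∀ t ∈ S, Y t = (X t - β) / δ) :
    auxK S a Y = δ ^ n * auxK S a X := by
  have hc : n = #(S.erase a) := by
    rw [card_erase_of_mem ha, hS]; omega
  conv_rhs => rw [hc]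
  unfold auxK
  rw [← prod_const, ← prod_mul_distrib]
  refine prod_congr rfl fun m hm => ?_
  have hm' : m ∈ S := by simp at hm; tauto
  rw [hY a ha, hY m hm', show (X a - β) / δ - (X m - β) / δ = (X a - X m) * δ⁻¹ by ring,
    mul_inv, inv_inv, mul_comm]

lemma Fzero_eq (n : ℕ) (hn : 2 ≤ n) (v : Fin (n - 1) → ℂ) :
    Fzero n v = (-1) ^ n * auxK (Icc 2 (n + 2)) (n + 1) (XextC n v) := by
  obtain ⟨m, rfl⟩ : ∃ m, n = m + 1 := ⟨n - 1, by omega⟩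
  have hset : (Icc 2 (m + 1 + 2)).erase (m + 1 + 1) = insert (m + 1 + 2) (Icc 2 (m + 1)) := by
    ext x; simp; omega
  unfold Fzero auxK
  rw [hset, prod_insert (by simp)]
  have h0 : XextC (m + 1) v (m + 1 + 1) = 0 := by simp [XextC]
  have h1 : XextC (m + 1) v (m + 1 + 2) = 1 := by simp [XextC]
  rw [h0, h1]
  have h2 : ∏ x ∈ Icc 2 (m + 1), (0 - XextC (m + 1) v x)⁻¹ = ∏ i : Fin m, (-1) * (v i)⁻¹ := by
    symm
    refine prod_bij (fun (i : Fin m) _ => (i : ℕ) + 2) ?_ ?_ ?_ ?_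
    · intro i _; have := i.2; rw [mem_Icc]; omega
    · intro i _ j _ h; ext; omega
    · intro b hb
      simp at hb
      exact ⟨⟨b - 2, by omega⟩, mem_univ _, Nat.sub_add_cancel hb.1⟩
    · intro i _
      have := i.2
      have : XextC (m + 1) v ((i : ℕ) + 2) = v i := by
        unfold XextC
        rw [if_neg (by omega), if_neg (by omega), dif_pos (by omega), dif_pos (by omega)]
        rfl
      rw [this, zero_sub, inv_neg]; ring
  rw [h2, prod_mul_distrib, prod_const, prod_inv_distrib, card_univ, Fintype.card_fin]
  have : ((-1 : ℂ) ^ m) * (-1) ^ m = 1 := by rw [← mul_pow]; simp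
  have h3 : (∏ i, v i) = ∏ i : Fin m, v i := rfl
  rw [h3, one_div, pow_succ, show ((0 : ℂ) - 1)⁻¹ = -1 by norm_num]
  linear_combination -(∏ i : Fin m, v i)⁻¹ * this

lemma mainAux (n : ℕ) (hn : 2 ≤ n) (w : ℕ × ℕ → ℂ) (c0 : ℂ) (hpar : Odd n ∨ Even n ∧ c0 = 0)
    (H : ∀ v ∈ ratOmega n, ∑ p ∈ (Icc 2 (n + 2) ×ˢ Icc 2 (n + 2)).filter
        (fun p => 2 ≤ p.1 ∧ p.1 ≤ n ∧ p.1 < p.2 ∧ p.2 ≤ n + 2),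
        w p * Fpair n p.1 p.2 v + c0 * Fzero n v = 0) :
    (∀ p : ℕ × ℕ, (2 ≤ p.1 ∧ p.1 ≤ n ∧ p.1 < p.2 ∧ p.2 ≤ n + 2) → w p = 0) ∧ c0 = 0 := by
  set S := Icc 2 (n + 2) with hSdef
  have hS : #S = n + 1 := by simp [hSdef]
  have haS : n + 1 ∈ S := by simp [hSdef]; omega
  have hbS : n + 2 ∈ S := by simp [hSdef]
  set h : ℕ → ℕ → ℂ := fun i j => if 2 ≤ i ∧ i ≤ n ∧ i < j ∧ j ≤ n + 2 then
    w (i, j) * auxsig S i j else 0 with hh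
  have HX : ∀ X : ℕ → ℂ, Set.InjOn X S →
      ∑ i ∈ S, ∑ j ∈ S.erase i, h i j * auxG S i j X + (c0 * (-1) ^ n) * auxK S (n + 1) X = 0 := by
    intro X hX
    have hδ : X (n + 2) - X (n + 1) ≠ 0 := sub_ne_zero.2 fun e => by
      have := hX hbS haS e; omega
    set δ := X (n + 2) - X (n + 1) with hδd
    set v : Fin (n - 1) → ℂ := fun i => (X (i + 2) - X (n + 1)) / δ with hv
    have hY : ∀ t ∈ S, XextC n v t = (X t - X (n + 1)) / δ := by
      intro t ht
      simp [hSdef] at ht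
      unfold XextC
      split_ifs with h1 h2 h3 h4
      · subst h1; simp
      · subst h2; rw [← hδd, div_self hδ]
      · simp only [hv]; rw [show t - 2 + 2 = t by omega]
      · omega
      · omega
    have hYinj : Set.InjOn (XextC n v) S := by
      intro p hp q hq e
      rw [hY p hp, hY q hq, div_left_inj' hδ, sub_left_inj] at e
      exact hX hp hq e
    have hmem : ∀ i : Fin (n - 1), (i : ℕ) + 2 ∈ S := fun i => by
      have := i.2; simp [hSdef]; omega
    have hvO : v ∈ ratOmega n := by
      refine ⟨fun i => ⟨fun e => ?_, fun e => ?_⟩, fun i j hij e => ?_⟩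
      · simp only [hv, div_eq_zero_iff, hδ, or_false, sub_eq_zero] at e
        have := hX (hmem i) haS e
        have := i.2; omega
      · simp only [hv, div_eq_one_iff_eq hδ] at e
        rw [hδd, sub_left_inj] at e
        have := hX (hmem i) hbS e
        have := i.2; omega
      · simp only [hv] at e
        rw [div_left_inj' hδ, sub_left_inj] at e
        have := hX (hmem i) (hmem j) e
        exact hij (by ext; omega)
    have hE := H v hvO
    rw [Fzero_eq n hn, auxK_scale n S hS _ haS X _ _ δ hY] at hE
    have hsum : ∑ p ∈ (S ×ˢ S).filter
        (fun p => 2 ≤ p.1 ∧ p.1 ≤ n ∧ p.1 < p.2 ∧ p.2 ≤ n + 2),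
        w p * Fpair n p.1 p.2 v = δ ^ n * ∑ i ∈ S, ∑ j ∈ S.erase i, h i j * auxG S i j X := by
      rw [sum_filter, sum_product, mul_sum]
      refine sum_congr rfl fun i hi => ?_
      rw [← add_sum_erase S _ hi, if_neg (by simp), zero_add, mul_sum]
      refine sum_congr rfl fun j hj => ?_
      have hj' : j ≠ i ∧ j ∈ S := by simpa using hj
      simp only [hh]
      split_ifs with hc
      · have := F_eq n S hS i j hi hj'.2 hj'.1.symm _ hYinj
        rw [Fpair, this, auxG_scale n S hS i j hi hj'.2 hj'.1.symm X _ _ δ hδ hY]; ring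
      · ring
    rw [hsum] at hE
    have : δ ^ n * (∑ i ∈ S, ∑ j ∈ S.erase i, h i j * auxG S i j X +
      (c0 * (-1) ^ n) * auxK S (n + 1) X) = 0 := by rw [← hE]; ring
    exact (mul_eq_zero.1 this).resolve_left (pow_ne_zero _ hδ)
  have C := core S (by omega) (n + 1) haS h _ HX
  rw [hS, Nat.add_sub_cancel] at C
  have hab : h (n + 1) (n + 2) = 0 ∧ h (n + 2) (n + 1) = 0 := by
    constructor <;> simp only [hh] <;> rw [if_neg (by omega)]
  -- symmetrised coefficients vanish
  set s : ℂ := (-1) ^ n with hs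
  have hss : s * s = 1 := by rw [hs, ← mul_pow]; simp
  set g : ℕ → ℕ → ℂ := fun k l => h k l + s * h l k with hg
  have gsw : ∀ k l, g k l = s * g l k := by
    intro k l; simp only [hg]; linear_combination -h k l * hss
  have gab : g (n + 1) (n + 2) = 0 := by simp [hg, hab]
  have g1 : ∀ l ∈ S, l ≠ n + 1 → g (n + 1) l = 0 := by
    intro l hl hla
    have := C (n + 1) haS l hl hla (n + 2) hbS (by omega)
    rw [if_neg hla, if_neg (by omega)] at this
    rw [← gab]; simpa [hg] using this
  have g2 : ∀ k ∈ S, k ≠ n + 1 → ∀ l ∈ S, l ≠ n + 1 → l ≠ k → g k l = -(c0 * s) := by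
    intro k hk hka l hl hla hlk
    have := C k hk l hl hlk (n + 1) haS hka.symm
    rw [if_neg hla, if_pos rfl] at this
    have h1 := g1 k hk hka
    have h2 := gsw k (n + 1)
    rw [h1, mul_zero] at h2
    simp only [hg] at h2 ⊢
    linear_combination this + h2
  have hc0 : c0 = 0 := by
    rcases hpar with ho | he
    · have hs1 : s = -1 := by rw [hs, ho.neg_one_pow]
      have h2S : 2 ∈ S := by simp [hSdef]
      have h1 := g2 2 h2S (by omega) (n + 2) hbS (by omega) (by omega)
      have h2 := g2 (n + 2) hbS (by omega) 2 h2S (by omega) (by omega)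
      have h3 := gsw 2 (n + 2)
      rw [h1, h2, hs1] at h3
      linear_combination h3 / 2
    · exact he.2
  have g3 : ∀ k ∈ S, ∀ l ∈ S, k ≠ l → g k l = 0 := by
    intro k hk l hl hkl
    by_cases h1 : k = n + 1
    · subst h1; exact g1 l hl hkl.symm
    by_cases h2 : l = n + 1
    · subst h2; rw [gsw, g1 k hk hkl, mul_zero]
    · rw [g2 k hk h1 l hl h2 hkl.symm, hc0]; simp
  refine ⟨fun p hp => ?_, hc0⟩
  have h1 := g3 p.1 (by simp [hSdef]; omega) p.2 (by simp [hSdef]; omega) (by omega)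
  simp only [hg, hh] at h1
  rw [if_pos hp, if_neg (by omega), mul_zero, add_zero] at h1
  exact (mul_eq_zero.1 h1).resolve_right (auxsig_ne _ _ _)

lemma sumAux (n : ℕ) [Fintype {p : ℕ × ℕ // 2 ≤ p.1 ∧ p.1 ≤ n ∧ p.1 < p.2 ∧ p.2 ≤ n + 2}]
    (g : {p : ℕ × ℕ // 2 ≤ p.1 ∧ p.1 ≤ n ∧ p.1 < p.2 ∧ p.2 ≤ n + 2} → ℂ)
    (v : Fin (n - 1) → ℂ) :
    ∑ p ∈ (Icc 2 (n + 2) ×ˢ Icc 2 (n + 2)).filter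
        (fun p => 2 ≤ p.1 ∧ p.1 ≤ n ∧ p.1 < p.2 ∧ p.2 ≤ n + 2),
        (if hp : 2 ≤ p.1 ∧ p.1 ≤ n ∧ p.1 < p.2 ∧ p.2 ≤ n + 2 then g ⟨p, hp⟩ else 0) *
          Fpair n p.1 p.2 v = ∑ p, g p * Fpair n p.1.1 p.1.2 v := by
  rw [Finset.sum_subtype (p := fun p : ℕ × ℕ => 2 ≤ p.1 ∧ p.1 ≤ n ∧ p.1 < p.2 ∧ p.2 ≤ n + 2)]
  · refine sum_congr rfl fun p _ => ?_
    rw [dif_pos p.2]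
  · intro x; simp; omega

lemma finAux (n : ℕ) : Finite {p : ℕ × ℕ // 2 ≤ p.1 ∧ p.1 ≤ n ∧ p.1 < p.2 ∧ p.2 ≤ n + 2} := by
  refine Set.Finite.subset (Finset.finite_toSet (Icc 2 (n + 2) ×ˢ Icc 2 (n + 2))) ?_
  intro p hp
  have hp' : 2 ≤ p.1 ∧ p.1 ≤ n ∧ p.1 < p.2 ∧ p.2 ≤ n + 2 := hp
  rw [Finset.mem_coe, Finset.mem_product, Finset.mem_Icc, Finset.mem_Icc]
  omega

end auxSec

/-- the family of the `(n−1)(n+2)/2` rational functions `F_{ij}` when `n` is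
even, respectively of these functions together with `F₀` when `n` is odd, is linearly
independent over `ℂ`. -/
theorem stmt16 (n : ℕ) (hn : 2 ≤ n) :
    (Even n → LinearIndependent ℂ
      (fun p : {p : ℕ × ℕ // 2 ≤ p.1 ∧ p.1 ≤ n ∧ p.1 < p.2 ∧ p.2 ≤ n + 2} =>
        (ratOmega n).restrict (Fpair n p.1.1 p.1.2))) ∧
    (Odd n → LinearIndependent ℂ
      (fun p : Option {p : ℕ × ℕ // 2 ≤ p.1 ∧ p.1 ≤ n ∧ p.1 < p.2 ∧ p.2 ≤ n + 2} =>
        Option.elim p ((ratOmega n).restrict (Fzero n))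
          (fun q => (ratOmega n).restrict (Fpair n q.1.1 q.1.2)))) := by
  have := finAux n
  let _ := Fintype.ofFinite {p : ℕ × ℕ // 2 ≤ p.1 ∧ p.1 ≤ n ∧ p.1 < p.2 ∧ p.2 ≤ n + 2}
  constructor
  · intro he
    rw [Fintype.linearIndependent_iff]
    intro g hg p
    have := (mainAux n hn (fun p => if hp : 2 ≤ p.1 ∧ p.1 ≤ n ∧ p.1 < p.2 ∧ p.2 ≤ n + 2 then
      g ⟨p, hp⟩ else 0) 0 (Or.inr ⟨he, rfl⟩) (fun v hv => by
        rw [sumAux, zero_mul, add_zero]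
        have hh := congrFun hg ⟨v, hv⟩
        simp [Finset.sum_apply] at hh
        exact hh)).1 p.1 p.2
    rwa [dif_pos p.2] at this
  · intro ho
    rw [Fintype.linearIndependent_iff]
    intro g hg
    have := mainAux n hn (fun p => if hp : 2 ≤ p.1 ∧ p.1 ≤ n ∧ p.1 < p.2 ∧ p.2 ≤ n + 2 then
      g (some ⟨p, hp⟩) else 0) (g none) (Or.inl ho) (fun v hv => by
        rw [sumAux n (fun p => g (some p)), add_comm]
        have hh := congrFun hg ⟨v, hv⟩
        simp [Finset.sum_apply, Fintype.sum_option] at hh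
        exact hh)
    intro p
    rcases p with _ | p
    · exact this.2
    · have h := this.1 p.1 p.2
      rwa [dif_pos p.2] at h
end

section
/- Let x1, x2, x3 be real numbers with 1 < x1 < x2 < x3. Define U1 = (x2, x3), U2 = (x1, x3), U3 = (x1, x2), U4 = ((x1−1)/(x3−1), (x2−1)/(x3−1)), U5 = (x1/x3, x2/x3), U6 = (x1·(x3−1)/(x3·(x1−1)), x2·(x3−1)/(x3·(x2−1))), writing U_i = (U_{i,1}, U_{i,2}). Then all the arguments of the logarithms below are positive and: log(U_{1,2}) − log(U_{2,2}) + log(U_{3,1}/U_{3,2}) + log( U_{4,2}·(U_{4,1}−1) / (U_{4,1}·(U_{4,2}−1)) ) + log(U_{5,2}/U_{5,1}) + log( (U_{6,2}−1)/(U_{6,1}−1) ) = 0. -/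
/-- one of the five logarithmic functional identities forming a basis of the
space of 'abelian' first-order abelian relations of the web `W_{0,6}`, together with the
positivity of all the arguments of the logarithms.  Here
`U₁ = (x₂,x₃)`, `U₂ = (x₁,x₃)`, `U₃ = (x₁,x₂)`, `U₄ = ((x₁−1)/(x₃−1), (x₂−1)/(x₃−1))`,
`U₅ = (x₁/x₃, x₂/x₃)`, `U₆ = (x₁(x₃−1)/(x₃(x₁−1)), x₂(x₃−1)/(x₃(x₂−1)))`. -/
theorem stmt18 (x1 x2 x3 : ℝ) (h1 : 1 < x1) (h12 : x1 < x2) (h23 : x2 < x3) :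
    let U11 := x2; let U12 := x3
    let U21 := x1; let U22 := x3
    let U31 := x1; let U32 := x2
    let U41 := (x1 - 1) / (x3 - 1); let U42 := (x2 - 1) / (x3 - 1)
    let U51 := x1 / x3; let U52 := x2 / x3
    let U61 := x1 * (x3 - 1) / (x3 * (x1 - 1)); let U62 := x2 * (x3 - 1) / (x3 * (x2 - 1))
    (0 < U12 ∧ 0 < U22 ∧ 0 < U31 / U32 ∧ 0 < U42 * (U41 - 1) / (U41 * (U42 - 1)) ∧
      0 < U52 / U51 ∧ 0 < (U62 - 1) / (U61 - 1)) ∧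
    Real.log U12 - Real.log U22 + Real.log (U31 / U32)
      + Real.log (U42 * (U41 - 1) / (U41 * (U42 - 1)))
      + Real.log (U52 / U51) + Real.log ((U62 - 1) / (U61 - 1)) = 0 := by
  intro U11 U12 U21 U22 U31 U32 U41 U42 U51 U52 U61 U62
  have a1 : 0 < x1 - 1 := by linarith
  have a2 : 0 < x2 - 1 := by linarith
  have a3 : 0 < x3 - 1 := by linarith
  have p1 : 0 < x1 := by linarith
  have p2 : 0 < x2 := by linarith
  have p3 : 0 < x3 := by linarith
  have d1 : 0 < x3 - x1 := by linarith
  have d2 : 0 < x3 - x2 := by linarith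
  have e41 : U41 - 1 = -((x3 - x1) / (x3 - 1)) := by
    simp only [U41]; field_simp; ring
  have e42 : U42 - 1 = -((x3 - x2) / (x3 - 1)) := by
    simp only [U42]; field_simp; ring
  have e61 : U61 - 1 = (x3 - x1) / (x3 * (x1 - 1)) := by
    simp only [U61]; field_simp; ring
  have e62 : U62 - 1 = (x3 - x2) / (x3 * (x2 - 1)) := by
    simp only [U62]; field_simp; ring
  have e4 : U42 * (U41 - 1) / (U41 * (U42 - 1))
      = ((x2 - 1) * (x3 - x1)) / ((x1 - 1) * (x3 - x2)) := by
    rw [e41, e42, mul_neg, mul_neg, neg_div_neg_eq]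
    simp only [U41, U42]; field_simp
  have e6 : (U62 - 1) / (U61 - 1)
      = (((x2 - 1) * (x3 - x1)) / ((x1 - 1) * (x3 - x2)))⁻¹ := by
    rw [e61, e62]; field_simp
  have e5 : U52 / U51 = (x1 / x2)⁻¹ := by
    simp only [U51, U52]; field_simp
  rw [e4, e5, e6]
  refine ⟨⟨p3, p3, div_pos p1 p2, by positivity, by positivity, by positivity⟩, ?_⟩
  rw [Real.log_inv, Real.log_inv]
  simp only [U12, U22, U31, U32]
  ring
end

section
/- For real numbers x2, x3, x4 pairwise distinct and all different from 0 and 1, let ε3(x2,x3,x4) = x2²·log|x2|/(x3·x4·(x2−1)(x2−x3)(x2−x4)) − x3²·log|x3|/(x2·x4·(x2−x3)(x3−1)(x3−x4)) + x4²·log|x4|/(x2·x3·(x4−1)(x2−x4)(x3−x4)) − (x2−1)²·log|x2−1|/(x2·(x2−x3)(x2−x4)(x3−1)(x4−1)) − (x2−x3)²·log|x2−x3|/(x2·x3·(x2−1)(x2−x4)(x3−1)(x3−x4)) + (x2−x4)²·log|x2−x4|/(x2·x4·(x2−1)(x4−1)(x2−x3)(x3−x4)) + (x3−1)²·log|x3−1|/(x3·(x2−1)(x4−1)(x2−x3)(x3−x4))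 − (x3−x4)²·log|x3−x4|/(x3·x4·(x4−1)(x3−1)(x2−x3)(x2−x4)) − (x4−1)²·log|x4−1|/(x4·(x2−1)(x3−1)(x2−x4)(x3−x4)). Let Ω ⊂ ℝ⁴ be the set of x = (x1,x2,x3,x4) with every xi ∉ {0,1} and xi ≠ xj for i ≠ j, and let C : Ω → Ω be C(x) = ( (1−x2)/(x1−x2), (1−x3)/(x1−x3), (1−x4)/(x1−x4), 1/x1 ). For i = 1,…,7 let V_i : Ω → ℝ³ have as components the coordinates 2, 3, 4 of the iterate C^{∘(i−1)}. Then for every x ∈ Ω (not only in the chamber 1 < x1 < x2 < x3 < x4, but on the whole of Ω) and all vectors w1, w2, w3 ∈ ℝ⁴: Σ_{i=1}^{7} ε3(V_i(x)) · det M_i = 0, where M_i is the 3×3 matrix whose (a,b) entry is the directional derivative at x of the a-th component of V_i in the direction w_b. -/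
/-- The explicit rational–logarithmic function `ε₃` (component of Euler's abelian relation
`E₄` of the web `W_{0,7}`). -/
noncomputable def eps3 (x2 x3 x4 : ℝ) : ℝ :=
  x2 ^ 2 * Real.log |x2| / (x3 * x4 * (x2 - 1) * (x2 - x3) * (x2 - x4))
    - x3 ^ 2 * Real.log |x3| / (x2 * x4 * (x2 - x3) * (x3 - 1) * (x3 - x4))
    + x4 ^ 2 * Real.log |x4| / (x2 * x3 * (x4 - 1) * (x2 - x4) * (x3 - x4))
    - (x2 - 1) ^ 2 * Real.log |x2 - 1| / (x2 * (x2 - x3) * (x2 - x4) * (x3 - 1) * (x4 - 1))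
    - (x2 - x3) ^ 2 * Real.log |x2 - x3| /
        (x2 * x3 * (x2 - 1) * (x2 - x4) * (x3 - 1) * (x3 - x4))
    + (x2 - x4) ^ 2 * Real.log |x2 - x4| /
        (x2 * x4 * (x2 - 1) * (x4 - 1) * (x2 - x3) * (x3 - x4))
    + (x3 - 1) ^ 2 * Real.log |x3 - 1| / (x3 * (x2 - 1) * (x4 - 1) * (x2 - x3) * (x3 - x4))
    - (x3 - x4) ^ 2 * Real.log |x3 - x4| /
        (x3 * x4 * (x4 - 1) * (x3 - 1) * (x2 - x3) * (x2 - x4))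
    - (x4 - 1) ^ 2 * Real.log |x4 - 1| / (x4 * (x2 - 1) * (x3 - 1) * (x2 - x4) * (x3 - x4))

/-- The cyclic map `C(x) = ((1−x₂)/(x₁−x₂), (1−x₃)/(x₁−x₃), (1−x₄)/(x₁−x₄), 1/x₁)` on `ℝ⁴`
(0-based indices). -/
noncomputable def C4 (x : Fin 4 → ℝ) : Fin 4 → ℝ :=
  ![(1 - x 1) / (x 0 - x 1), (1 - x 2) / (x 0 - x 2), (1 - x 3) / (x 0 - x 3), 1 / x 0]

/-- The set `Ω ⊂ ℝ⁴` of points with all coordinates `∉ {0,1}` and pairwise distinct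
(the real moduli space `M_{0,7}(ℝ)`). -/
def Omega19 : Set (Fin 4 → ℝ) :=
  {x | (∀ i, x i ≠ 0 ∧ x i ≠ 1) ∧ ∀ i j, i ≠ j → x i ≠ x j}

/-- Homogeneous coordinates of the seven points `x₁,x₂,x₃,x₄,0,1,∞`: numerators. -/
noncomputable def zp (x : Fin 4 → ℝ) : Fin 7 → ℝ := ![x 0, x 1, x 2, x 3, 0, 1, 1]

/-- Homogeneous coordinates: denominators. -/
noncomputable def zq : Fin 7 → ℝ := ![1, 1, 1, 1, 1, 1, 0]

/-- Brackets of two of the seven points. -/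
noncomputable def br (x : Fin 4 → ℝ) (i j : Fin 7) : ℝ := zp x i * zq j - zp x j * zq i

/-- Product of all the brackets starting at `j`. -/
noncomputable def pr (x : Fin 4 → ℝ) (j : Fin 7) : ℝ := ∏ l ∈ Finset.univ.erase j, br x j l

/-- The symmetric form of the abelian relation components. -/
noncomputable def HH (x : Fin 4 → ℝ) (i : Fin 7) : ℝ :=
  ∑ j, ∑ k, br x j k ^ 4 * (br x i j * br x i k) / (pr x j * pr x k) * Real.log (br x j k)

lemma br_self (x : Fin 4 → ℝ) (i : Fin 7) : br x i i = 0 := by simp [br]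

lemma br_ne (x : Fin 4 → ℝ) (hx : x ∈ Omega19) (i j : Fin 7) (h : i ≠ j) : br x i j ≠ 0 := by
  obtain ⟨h1, h2⟩ := hx
  have e01 := sub_ne_zero.2 (h2 0 1 (by decide))
  have e02 := sub_ne_zero.2 (h2 0 2 (by decide))
  have e03 := sub_ne_zero.2 (h2 0 3 (by decide))
  have e12 := sub_ne_zero.2 (h2 1 2 (by decide))
  have e13 := sub_ne_zero.2 (h2 1 3 (by decide))
  have e23 := sub_ne_zero.2 (h2 2 3 (by decide))
  have e10 := sub_ne_zero.2 (h2 1 0 (by decide))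
  have e20 := sub_ne_zero.2 (h2 2 0 (by decide))
  have e30 := sub_ne_zero.2 (h2 3 0 (by decide))
  have e21 := sub_ne_zero.2 (h2 2 1 (by decide))
  have e31 := sub_ne_zero.2 (h2 3 1 (by decide))
  have e32 := sub_ne_zero.2 (h2 3 2 (by decide))
  have f0 := sub_ne_zero.2 (h1 0).2
  have f1 := sub_ne_zero.2 (h1 1).2
  have f2 := sub_ne_zero.2 (h1 2).2
  have f3 := sub_ne_zero.2 (h1 3).2
  have g0 := sub_ne_zero.2 (h1 0).2.symm
  have g1 := sub_ne_zero.2 (h1 1).2.symm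
  have g2 := sub_ne_zero.2 (h1 2).2.symm
  have g3 := sub_ne_zero.2 (h1 3).2.symm
  have k0 := (h1 0).1
  have k1 := (h1 1).1
  have k2 := (h1 2).1
  have k3 := (h1 3).1
  fin_cases i <;> fin_cases j <;> first | exact absurd rfl h | (simp [br, zp, zq]; done) |
    (simp [br, zp, zq]; assumption)

lemma mem_of_br (x : Fin 4 → ℝ) (h : ∀ i j : Fin 7, i ≠ j → br x i j ≠ 0) : x ∈ Omega19 := by
  have e01 := h 0 1 (by decide)
  have e02 := h 0 2 (by decide)
  have e03 := h 0 3 (by decide)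
  have e12 := h 1 2 (by decide)
  have e13 := h 1 3 (by decide)
  have e23 := h 2 3 (by decide)
  have f0 := h 0 4 (by decide)
  have f1 := h 1 4 (by decide)
  have f2 := h 2 4 (by decide)
  have f3 := h 3 4 (by decide)
  have g0 := h 0 5 (by decide)
  have g1 := h 1 5 (by decide)
  have g2 := h 2 5 (by decide)
  have g3 := h 3 5 (by decide)
  simp [br, zp, zq, sub_eq_zero] at e01 e02 e03 e12 e13 e23 f0 f1 f2 f3 g0 g1 g2 g3
  refine ⟨fun i => ?_, fun i j hij => ?_⟩
  · fin_cases i <;> constructor <;> assumption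
  · fin_cases i <;> fin_cases j <;> first | exact absurd rfl hij | assumption |
      (apply Ne.symm; assumption)

lemma pr_ne (x : Fin 4 → ℝ) (hx : x ∈ Omega19) (j : Fin 7) : pr x j ≠ 0 :=
  Finset.prod_ne_zero_iff.2 fun l hl => br_ne x hx j l (Finset.ne_of_mem_erase hl).symm

/-- Scaling factors of the cyclic map. -/
noncomputable def lam (x : Fin 4 → ℝ) : Fin 7 → ℝ :=
  ![1 / (x 0 - x 1), 1 / (x 0 - x 2), 1 / (x 0 - x 3), 1 / x 0, 1 / (x 0 - 1), -1, 1 / (1 - x 0)]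

lemma lam_ne (x : Fin 4 → ℝ) (hx : x ∈ Omega19) (i : Fin 7) : lam x i ≠ 0 := by
  obtain ⟨h1, h2⟩ := hx
  have e01 := sub_ne_zero.2 (h2 0 1 (by decide))
  have e02 := sub_ne_zero.2 (h2 0 2 (by decide))
  have e03 := sub_ne_zero.2 (h2 0 3 (by decide))
  have f0 := sub_ne_zero.2 (h1 0).2
  have g0 := sub_ne_zero.2 (h1 0).2.symm
  have k0 := (h1 0).1
  fin_cases i <;> first | (simp [lam]; done) | (simp [lam]; assumption)

lemma zp_C (x : Fin 4 → ℝ) (hx : x ∈ Omega19) (i : Fin 7) :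
    zp (C4 x) i = lam x i * (zq (i + 1) - zp x (i + 1)) := by
  obtain ⟨h1, h2⟩ := hx
  have g0 := sub_ne_zero.2 (h1 0).2.symm
  have h6 : (6 : Fin 7) + 1 = 0 := rfl
  fin_cases i <;> simp [lam, zp, zq, C4, h6, g0] <;> ring

lemma zq_C (x : Fin 4 → ℝ) (hx : x ∈ Omega19) (i : Fin 7) :
    zq i = lam x i * (x 0 * zq (i + 1) - zp x (i + 1)) := by
  obtain ⟨h1, h2⟩ := hx
  have e01 := sub_ne_zero.2 (h2 0 1 (by decide))
  have e02 := sub_ne_zero.2 (h2 0 2 (by decide))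
  have e03 := sub_ne_zero.2 (h2 0 3 (by decide))
  have f0 := sub_ne_zero.2 (h1 0).2
  have k0 := (h1 0).1
  have h6 : (6 : Fin 7) + 1 = 0 := rfl
  fin_cases i <;> simp [lam, zp, zq, *]

lemma br_C (x : Fin 4 → ℝ) (hx : x ∈ Omega19) (i j : Fin 7) :
    br (C4 x) i j = (1 - x 0) * (lam x i * lam x j) * br x (i + 1) (j + 1) := by
  have h1 := zq_C x hx i
  have h2 := zq_C x hx j
  unfold br
  rw [zp_C x hx i, zp_C x hx j, h1, h2]
  ring

lemma one_sub_ne (x : Fin 4 → ℝ) (hx : x ∈ Omega19) : 1 - x 0 ≠ 0 :=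
  sub_ne_zero.2 (hx.1 0).2.symm

lemma C4_mem (x : Fin 4 → ℝ) (hx : x ∈ Omega19) : C4 x ∈ Omega19 := by
  apply mem_of_br
  intro i j h
  rw [br_C x hx]
  refine mul_ne_zero (mul_ne_zero (one_sub_ne x hx) (mul_ne_zero (lam_ne x hx _) (lam_ne x hx _)))
    (br_ne x hx _ _ fun h' => h (add_right_cancel h'))

lemma pr_C (x : Fin 4 → ℝ) (hx : x ∈ Omega19) (j : Fin 7) :
    pr (C4 x) j = (1 - x 0) ^ 6 * lam x j ^ 5 * (∏ l, lam x l) * pr x (j + 1) := by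
  have h1 : pr x (j + 1) = ∏ l ∈ Finset.univ.erase j, br x (j + 1) (l + 1) := by
    unfold pr
    symm
    refine Finset.prod_bij (fun l _ => l + 1) ?_ ?_ ?_ ?_
    · intro l hl
      simpa using hl
    · intro a _ b _ h
      exact add_right_cancel h
    · intro b hb
      refine ⟨b - 1, ?_, sub_add_cancel b 1⟩
      simp only [Finset.mem_erase, Finset.mem_univ, and_true] at hb ⊢
      intro h
      apply hb
      exact sub_eq_iff_eq_add.1 h
    · intros; rfl
  rw [h1]
  unfold pr
  simp_rw [br_C x hx, Finset.prod_mul_distrib]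
  rw [← Finset.mul_prod_erase Finset.univ (lam x) (Finset.mem_univ j)]
  simp only [Finset.prod_const, Finset.card_erase_of_mem (Finset.mem_univ j), Finset.card_univ,
    Fintype.card_fin]
  ring

lemma pr_eq (x : Fin 4 → ℝ) (j : Fin 7) : pr x j =
    ![-((x 0 - x 1) * (x 0 - x 2) * (x 0 - x 3) * x 0 * (x 0 - 1)),
      (x 0 - x 1) * (x 1 - x 2) * (x 1 - x 3) * x 1 * (x 1 - 1),
      -((x 0 - x 2) * (x 1 - x 2) * (x 2 - x 3) * x 2 * (x 2 - 1)),
      (x 0 - x 3) * (x 1 - x 3) * (x 2 - x 3) * x 3 * (x 3 - 1),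
      x 0 * x 1 * x 2 * x 3,
      -((x 0 - 1) * (x 1 - 1) * (x 2 - 1) * (x 3 - 1)), 1] j := by
  have h : pr x j = ∏ l, if l = j then 1 else br x j l := by
    unfold pr
    rw [← Finset.mul_prod_erase Finset.univ _ (Finset.mem_univ j), if_pos rfl, one_mul]
    refine Finset.prod_congr rfl fun l hl => ?_
    rw [if_neg (Finset.ne_of_mem_erase hl)]
  rw [h]
  fin_cases j <;> simp [Fin.prod_univ_seven, br, zp, zq, -mul_eq_mul_left_iff, -mul_eq_mul_right_iff] <;> ring

/-- Lagrange-type identity. -/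
lemma lagr_s19 (x : Fin 4 → ℝ) (hx : x ∈ Omega19) (m : Fin 6) :
    ∑ k, zp x k ^ (m : ℕ) * zq k ^ (5 - (m : ℕ)) / pr x k = 0 := by
  obtain ⟨h1, h2⟩ := hx
  have p := fun j => pr_eq x j
  simp only [Fin.sum_univ_seven]
  rw [p 0, p 1, p 2, p 3, p 4, p 5, p 6]
  have e01 := sub_ne_zero.2 (h2 0 1 (by decide))
  have e02 := sub_ne_zero.2 (h2 0 2 (by decide))
  have e03 := sub_ne_zero.2 (h2 0 3 (by decide))
  have e12 := sub_ne_zero.2 (h2 1 2 (by decide))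
  have e13 := sub_ne_zero.2 (h2 1 3 (by decide))
  have e23 := sub_ne_zero.2 (h2 2 3 (by decide))
  have f0 := sub_ne_zero.2 (h1 0).2
  have f1 := sub_ne_zero.2 (h1 1).2
  have f2 := sub_ne_zero.2 (h1 2).2
  have f3 := sub_ne_zero.2 (h1 3).2
  have k0 := (h1 0).1
  have k1 := (h1 1).1
  have k2 := (h1 2).1
  have k3 := (h1 3).1
  fin_cases m <;> simp [zp, zq]
  all_goals
    field_simp
    ring

lemma sum_rho (x : Fin 4 → ℝ) (hx : x ∈ Omega19) (i j : Fin 7) :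
    ∑ k, br x j k ^ 4 * br x i k / pr x k = 0 := by
  have h := fun m => lagr_s19 x hx m
  set a := zp x j
  set b := zq j
  set c := zp x i
  set d := zq i
  have key : ∀ k, br x j k ^ 4 * br x i k / pr x k =
      a ^ 4 * c * (zp x k ^ ((0 : Fin 6) : ℕ) * zq k ^ (5 - ((0 : Fin 6) : ℕ)) / pr x k)
      + (-4 * a ^ 3 * b * c - a ^ 4 * d) *
        (zp x k ^ ((1 : Fin 6) : ℕ) * zq k ^ (5 - ((1 : Fin 6) : ℕ)) / pr x k)
      + (6 * a ^ 2 * b ^ 2 * c + 4 * a ^ 3 * b * d) *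
        (zp x k ^ ((2 : Fin 6) : ℕ) * zq k ^ (5 - ((2 : Fin 6) : ℕ)) / pr x k)
      + (-4 * a * b ^ 3 * c - 6 * a ^ 2 * b ^ 2 * d) *
        (zp x k ^ ((3 : Fin 6) : ℕ) * zq k ^ (5 - ((3 : Fin 6) : ℕ)) / pr x k)
      + (b ^ 4 * c + 4 * a * b ^ 3 * d) *
        (zp x k ^ ((4 : Fin 6) : ℕ) * zq k ^ (5 - ((4 : Fin 6) : ℕ)) / pr x k)
      + (- b ^ 4 * d) *
        (zp x k ^ ((5 : Fin 6) : ℕ) * zq k ^ (5 - ((5 : Fin 6) : ℕ)) / pr x k) := by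
    intro k
    have e0 : ((0 : Fin 6) : ℕ) = 0 := rfl
    have e1 : ((1 : Fin 6) : ℕ) = 1 := rfl
    have e2 : ((2 : Fin 6) : ℕ) = 2 := rfl
    have e3 : ((3 : Fin 6) : ℕ) = 3 := rfl
    have e4 : ((4 : Fin 6) : ℕ) = 4 := rfl
    have e5 : ((5 : Fin 6) : ℕ) = 5 := rfl
    rw [e0, e1, e2, e3, e4, e5]
    norm_num only
    simp only [br]
    ring
  simp_rw [key, Finset.sum_add_distrib, ← Finset.mul_sum, h]
  ring

lemma HH_C (x : Fin 4 → ℝ) (hx : x ∈ Omega19) (i : Fin 7) :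
    HH (C4 x) i = lam x i ^ 2 / ((1 - x 0) ^ 6 * (∏ l, lam x l) ^ 2) * HH x (i + 1) := by
  have hD := one_sub_ne x hx
  have hl := lam_ne x hx
  have hL : (∏ l, lam x l) ≠ 0 := Finset.prod_ne_zero_iff.2 fun l _ => hl l
  set L := ∏ l, lam x l with hLdef
  have key : ∀ j k, br (C4 x) j k ^ 4 * (br (C4 x) i j * br (C4 x) i k) /
      (pr (C4 x) j * pr (C4 x) k) * Real.log (br (C4 x) j k) =
      lam x i ^ 2 / ((1 - x 0) ^ 6 * L ^ 2) *
      ((br x (j+1) (k+1) ^ 4 * (br x (i+1) (j+1) * br x (i+1) (k+1)) /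
        (pr x (j+1) * pr x (k+1)) * Real.log (br x (j+1) (k+1)))
      + (br x (i+1) (j+1) / pr x (j+1) * (Real.log (1 - x 0) + Real.log (lam x j))) *
          (br x (j+1) (k+1) ^ 4 * br x (i+1) (k+1) / pr x (k+1))
      + (br x (i+1) (k+1) / pr x (k+1) * Real.log (lam x k)) *
          (br x (k+1) (j+1) ^ 4 * br x (i+1) (j+1) / pr x (j+1))) := by
    intro j k
    have hs : br x (k+1) (j+1) = - br x (j+1) (k+1) := by unfold br; ring
    by_cases hjk : j = k
    · subst hjk
      simp [br_self]
    have hb := br_ne x hx (j+1) (k+1) (fun h' => hjk (add_right_cancel h'))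
    have hpj := pr_ne x hx (j+1)
    have hpk := pr_ne x hx (k+1)
    have hlj := hl j
    have hlk := hl k
    rw [hs, br_C x hx j k, br_C x hx i j, br_C x hx i k, pr_C x hx j, pr_C x hx k, ← hLdef,
      Real.log_mul (mul_ne_zero hD (mul_ne_zero hlj hlk)) hb,
      Real.log_mul hD (mul_ne_zero hlj hlk), Real.log_mul hlj hlk]
    field_simp
    ring
  have sh : ∀ f : Fin 7 → ℝ, ∑ k, f (k + 1) = ∑ k, f k := fun f =>
    Equiv.sum_comp (Equiv.addRight (1 : Fin 7)) f
  unfold HH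
  simp_rw [key, ← Finset.mul_sum, Finset.sum_add_distrib]
  congr 1
  have s1 : ∑ j, ∑ k, (br x (i+1) (j+1) / pr x (j+1) *
      (Real.log (1 - x 0) + Real.log (lam x j))) *
          (br x (j+1) (k+1) ^ 4 * br x (i+1) (k+1) / pr x (k+1)) = 0 := by
    refine Finset.sum_eq_zero fun j _ => ?_
    rw [← Finset.mul_sum, sh (fun k => br x (j+1) k ^ 4 * br x (i+1) k / pr x k),
      sum_rho x hx, mul_zero]
  have s2 : ∑ j, ∑ k, (br x (i+1) (k+1) / pr x (k+1) * Real.log (lam x k)) *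
          (br x (k+1) (j+1) ^ 4 * br x (i+1) (j+1) / pr x (j+1)) = 0 := by
    rw [Finset.sum_comm]
    refine Finset.sum_eq_zero fun k _ => ?_
    rw [← Finset.mul_sum, sh (fun j => br x (k+1) j ^ 4 * br x (i+1) j / pr x j),
      sum_rho x hx, mul_zero]
  rw [s1, s2, add_zero, add_zero]
  rw [← sh (fun j => ∑ k, br x j k ^ 4 * (br x (i+1) j * br x (i+1) k) / (pr x j * pr x k) *
    Real.log (br x j k))]
  refine Finset.sum_congr rfl fun j _ => ?_
  exact sh (fun k => br x (j+1) k ^ 4 * (br x (i+1) (j+1) * br x (i+1) k) /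
    (pr x (j+1) * pr x k) * Real.log (br x (j+1) k))

lemma HH_lin (x : Fin 4 → ℝ) (l : Fin 4) :
    HH x l.castSucc.castSucc.castSucc =
      x l * HH x 5 + (x l ^ 2 - x l) * HH x 6 + (1 - x l) * HH x 4 := by
  unfold HH
  simp_rw [Finset.mul_sum, ← Finset.sum_add_distrib]
  refine Finset.sum_congr rfl fun j _ => Finset.sum_congr rfl fun k _ => ?_
  have h1 : ∀ j, br x l.castSucc.castSucc.castSucc j = x l * zq j - zp x j := by
    intro j
    fin_cases l <;> simp [br, zp, zq]
  have h4 : ∀ j, br x 4 j = - zp x j := by intro j; simp [br, zp, zq]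
  have h5 : ∀ j, br x 5 j = zq j - zp x j := by intro j; simp [br, zp, zq]
  have h6 : ∀ j, br x 6 j = zq j := by intro j; simp [br, zp, zq]
  rw [h1, h1, h4, h4, h5, h5, h6, h6]
  ring

/-- Derivative of the cyclic map. -/
noncomputable def dC (x v : Fin 4 → ℝ) : Fin 4 → ℝ :=
  ![((1 - x 0) * v 1 - (1 - x 1) * v 0) / (x 0 - x 1) ^ 2,
    ((1 - x 0) * v 2 - (1 - x 2) * v 0) / (x 0 - x 2) ^ 2,
    ((1 - x 0) * v 3 - (1 - x 3) * v 0) / (x 0 - x 3) ^ 2,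
    - v 0 / x 0 ^ 2]

lemma hasF (x : Fin 4 → ℝ) (k : Fin 4) :
    HasFDerivAt (fun y : Fin 4 → ℝ => y k) (ContinuousLinearMap.proj (R := ℝ) k) x :=
  hasFDerivAt_apply k x

lemma C4_diff (x : Fin 4 → ℝ) (hx : x ∈ Omega19) :
    DifferentiableAt ℝ C4 x ∧ ∀ v, fderiv ℝ C4 x v = dC x v := by
  obtain ⟨h1, h2⟩ := hx
  have gen : ∀ k : Fin 4, x 0 - x k ≠ 0 → HasFDerivAt
      (fun y : Fin 4 → ℝ => (1 - y k) / (y 0 - y k)) _ x := fun k hk =>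
    HasFDerivAt.fun_mul ((hasF x k).const_sub 1)
      ((hasDerivAt_inv hk).comp_hasFDerivAt x ((hasF x 0).fun_sub (hasF x k)))
  have g1 := gen 1 (sub_ne_zero.2 (h2 0 1 (by decide)))
  have g2 := gen 2 (sub_ne_zero.2 (h2 0 2 (by decide)))
  have g3 := gen 3 (sub_ne_zero.2 (h2 0 3 (by decide)))
  have g4 : HasFDerivAt (fun y : Fin 4 → ℝ => 1 / y 0) _ x :=
    HasFDerivAt.fun_mul (hasFDerivAt_const (1 : ℝ) x)
      ((hasDerivAt_inv (h1 0).1).comp_hasFDerivAt x (hasF x 0))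
  have hd : ∀ i, DifferentiableAt ℝ (fun y => C4 y i) x := by
    intro i
    fin_cases i
    · exact g1.differentiableAt
    · exact g2.differentiableAt
    · exact g3.differentiableAt
    · exact g4.differentiableAt
  have hD : DifferentiableAt ℝ C4 x := differentiableAt_pi.2 hd
  refine ⟨hD, fun v => ?_⟩
  funext i
  have : fderiv ℝ C4 x v i = fderiv ℝ (fun y => C4 y i) x v := by
    rw [((hasFDerivAt_pi'.1 hD.hasFDerivAt) i).fderiv]
    rfl
  rw [this]
  fin_cases i
  · refine (congrArg (fun L => L v) g1.fderiv).trans ?_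
    simp [dC]; field_simp; ring
  · refine (congrArg (fun L => L v) g2.fderiv).trans ?_
    simp [dC]; field_simp; ring
  · refine (congrArg (fun L => L v) g3.fderiv).trans ?_
    simp [dC]; field_simp; ring
  · refine (congrArg (fun L => L v) g4.fderiv).trans ?_
    simp [dC]; field_simp

lemma iter_diff (n : ℕ) : ∀ x ∈ Omega19, DifferentiableAt ℝ (C4^[n]) x := by
  induction n with
  | zero => intro x _; exact differentiableAt_id
  | succ n ih =>
    intro x hx
    rw [Function.iterate_succ]
    exact (ih _ (C4_mem x hx)).comp x (C4_diff x hx).1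

lemma fderiv_step (n : ℕ) (x : Fin 4 → ℝ) (hx : x ∈ Omega19) (a : Fin 4) (v : Fin 4 → ℝ) :
    fderiv ℝ (fun y => C4^[n + 1] y a) x v = fderiv ℝ (fun y => C4^[n] y a) (C4 x) (dC x v) := by
  have h1 : (fun y => C4^[n + 1] y a) = (fun y => C4^[n] y a) ∘ C4 := by
    funext y
    simp [Function.iterate_succ]
  have h2 : DifferentiableAt ℝ (fun y => C4^[n] y a) (C4 x) :=
    differentiableAt_pi.1 (iter_diff n _ (C4_mem x hx)) a
  rw [h1, fderiv_comp x h2 (C4_diff x hx).1, ContinuousLinearMap.comp_apply,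
    (C4_diff x hx).2]

/-- `3 × 3` minors of three vectors of `ℝ⁴`. -/
noncomputable def mi (w : Fin 3 → Fin 4 → ℝ) (i j k : Fin 4) : ℝ :=
  w 0 i * (w 1 j * w 2 k - w 1 k * w 2 j) - w 1 i * (w 0 j * w 2 k - w 0 k * w 2 j)
    + w 2 i * (w 0 j * w 1 k - w 0 k * w 1 j)

/-- The determinant of a vector and three other vectors of `ℝ⁴`. -/
noncomputable def det4 (v : Fin 4 → ℝ) (w : Fin 3 → Fin 4 → ℝ) : ℝ :=
  v 0 * mi w 1 2 3 - v 1 * mi w 0 2 3 + v 2 * mi w 0 1 3 - v 3 * mi w 0 1 2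

/-- Vector fields spanning the kernels of the forgetful maps. -/
noncomputable def ka (x : Fin 4 → ℝ) : Fin 7 → Fin 4 → ℝ :=
  ![![1, 0, 0, 0], ![0, 1, 0, 0], ![0, 0, 1, 0], ![0, 0, 0, 1],
    fun l => x l - 1, fun l => - x l, fun l => - (x l ^ 2 - x l)]

lemma ka_C (x : Fin 4 → ℝ) (hx : x ∈ Omega19) (w : Fin 3 → Fin 4 → ℝ) (i : Fin 7) (hi : i ≠ 6) :
    lam x i ^ 2 / ((1 - x 0) ^ 6 * (∏ l, lam x l) ^ 2) *
      det4 (ka (C4 x) i) (fun b => dC x (w b)) = det4 (ka x (i + 1)) w := by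
  obtain ⟨h1, h2⟩ := hx
  have e01 := sub_ne_zero.2 (h2 0 1 (by decide))
  have e02 := sub_ne_zero.2 (h2 0 2 (by decide))
  have e03 := sub_ne_zero.2 (h2 0 3 (by decide))
  have f0 := sub_ne_zero.2 (h1 0).2
  have g0 := sub_ne_zero.2 (h1 0).2.symm
  have k0 := (h1 0).1
  have hF : (1 - x 0) ^ 6 * (∏ l, lam x l) ^ 2 = (1 - x 0) ^ 2 /
      ((x 0 - x 1) ^ 2 * (x 0 - x 2) ^ 2 * (x 0 - x 3) ^ 2 * x 0 ^ 2) := by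
    have : (x 0 - 1) ^ 2 = (1 - x 0) ^ 2 := by ring
    simp only [Fin.prod_univ_seven, lam, mul_pow]
    simp [this]
    field_simp
  rw [hF]
  have q3 : (3 : Fin 7) + 1 = 4 := rfl
  have q4 : (4 : Fin 7) + 1 = 5 := rfl
  have q5 : (5 : Fin 7) + 1 = 6 := rfl
  have f0' : x 0 - 1 = - (1 - x 0) := by ring
  fin_cases i
  · simp [lam, det4, ka, mi, dC]
    field_simp
    ring
  · simp [lam, det4, ka, mi, dC]
    field_simp
    ring
  · simp [lam, det4, ka, mi, dC]
    field_simp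
    ring
  · simp [lam, det4, ka, mi, dC, q3]
    field_simp
    ring
  · simp [lam, det4, ka, mi, dC, q4, C4]
    rw [f0']
    field_simp
    ring
  · simp [lam, det4, ka, mi, dC, q5, C4]
    field_simp
    ring
  · exact absurd rfl hi

/-- Inductive claim. -/
def Claim (n : ℕ) (i : Fin 7) : Prop := ∀ x ∈ Omega19, ∀ w : Fin 3 → Fin 4 → ℝ,
  eps3 (C4^[n] x 1) (C4^[n] x 2) (C4^[n] x 3) *
        (Matrix.of fun a b : Fin 3 =>
          fderiv ℝ (fun y => C4^[n] y a.succ) x (w b)).det = (1 / 2) * HH x i * det4 (ka x i) w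

lemma claim_step (n : ℕ) (i : Fin 7) (hi : i ≠ 6) (h : Claim n i) : Claim (n + 1) (i + 1) := by
  intro x hx w
  have h' := h (C4 x) (C4_mem x hx) (fun b => dC x (w b))
  simp_rw [fderiv_step n x hx]
  simp only [Function.iterate_succ, Function.comp_apply]
  rw [h', HH_C x hx, ← ka_C x hx w i hi]
  ring

lemma claim_zero (hE : ∀ x ∈ Omega19, eps3 (x 1) (x 2) (x 3) = (1 / 2) * HH x 0) : Claim 0 0 := by
  intro x hx w
  have : ∀ (a : Fin 4) (v : Fin 4 → ℝ), fderiv ℝ (fun y : Fin 4 → ℝ => y a) x v = v a := by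
    intro a v
    rw [(hasF x a).fderiv]; rfl
  simp only [Function.iterate_zero, id, this]
  rw [hE x hx, Matrix.det_fin_three]
  simp [det4, ka, mi]
  left
  ring

lemma eps3_HH (x : Fin 4 → ℝ) (hx : x ∈ Omega19) :
    eps3 (x 1) (x 2) (x 3) = (1 / 2) * HH x 0 := by
  obtain ⟨h1, h2⟩ := hx
  set t : Fin 7 → Fin 7 → ℝ := fun j k =>
    br x j k ^ 4 * (br x 0 j * br x 0 k) / (pr x j * pr x k) * Real.log (br x j k) with ht
  have sy : ∀ j k, t j k = t k j := by
    intro j k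
    have : br x k j = - br x j k := by unfold br; ring
    simp only [ht]
    rw [this, Real.log_neg_eq_log]
    ring
  have td : ∀ j, t j j = 0 := by intro j; simp [ht, br_self]
  have t0 : ∀ k, t 0 k = 0 := by intro j; simp [ht, br_self]
  have t6 : ∀ k, t k 6 = 0 := by
    intro k
    fin_cases k <;> simp [ht, br, zp, zq]
  have t45 : t 4 5 = 0 := by simp [ht, br, zp, zq]
  have hH : HH x 0 = 2 * (t 1 2 + t 1 3 + t 1 4 + t 1 5 + t 2 3 + t 2 4 + t 2 5
      + t 3 4 + t 3 5) := by
    change ∑ j, ∑ k, t j k = _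
    simp only [Fin.sum_univ_seven, td, t0, t6, t45, sy 1 0, sy 2 0, sy 3 0, sy 4 0, sy 5 0, sy 6 0,
      sy 2 1, sy 3 1, sy 4 1, sy 5 1, sy 6 1, sy 3 2, sy 4 2, sy 5 2, sy 6 2, sy 4 3, sy 5 3,
      sy 6 3, sy 5 4, sy 6 4, sy 6 5]
    ring
  rw [hH]
  have e01 := sub_ne_zero.2 (h2 0 1 (by decide))
  have e02 := sub_ne_zero.2 (h2 0 2 (by decide))
  have e03 := sub_ne_zero.2 (h2 0 3 (by decide))
  have e12 := sub_ne_zero.2 (h2 1 2 (by decide))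
  have e13 := sub_ne_zero.2 (h2 1 3 (by decide))
  have e23 := sub_ne_zero.2 (h2 2 3 (by decide))
  have f0 := sub_ne_zero.2 (h1 0).2
  have f1 := sub_ne_zero.2 (h1 1).2
  have f2 := sub_ne_zero.2 (h1 2).2
  have f3 := sub_ne_zero.2 (h1 3).2
  have k0 := (h1 0).1
  have k1 := (h1 1).1
  have k2 := (h1 2).1
  have k3 := (h1 3).1
  simp only [ht, pr_eq]
  simp only [eps3, Real.log_abs]
  simp only [br, zp, zq, Matrix.cons_val, mul_one, sub_zero]
  generalize Real.log (x 1 - x 2) = L12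
  generalize Real.log (x 1 - x 3) = L13
  generalize Real.log (x 2 - x 3) = L23
  generalize Real.log (x 1 - 1) = M1
  generalize Real.log (x 2 - 1) = M2
  generalize Real.log (x 3 - 1) = M3
  generalize Real.log (x 1) = N1
  generalize Real.log (x 2) = N2
  generalize Real.log (x 3) = N3
  field_simp
  ring

theorem stmt19 (x : Fin 4 → ℝ) (hx : x ∈ Omega19) (w : Fin 3 → (Fin 4 → ℝ)) :
    ∑ i ∈ Finset.range 7,
      eps3 (C4^[i] x 1) (C4^[i] x 2) (C4^[i] x 3) *
        (Matrix.of fun a b : Fin 3 =>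
          fderiv ℝ (fun y => C4^[i] y a.succ) x (w b)).det = 0 := by
  have c0 : Claim 0 0 := claim_zero eps3_HH
  have c1 : Claim 1 1 := claim_step 0 0 (by decide) c0
  have c2 : Claim 2 2 := claim_step 1 1 (by decide) c1
  have c3 : Claim 3 3 := claim_step 2 2 (by decide) c2
  have c4 : Claim 4 4 := claim_step 3 3 (by decide) c3
  have c5 : Claim 5 5 := claim_step 4 4 (by decide) c4
  have c6 : Claim 6 6 := claim_step 5 5 (by decide) c5
  rw [Finset.sum_range_succ, Finset.sum_range_succ, Finset.sum_range_succ, Finset.sum_range_succ,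
    Finset.sum_range_succ, Finset.sum_range_succ, Finset.sum_range_one,
    c0 x hx w, c1 x hx w, c2 x hx w, c3 x hx w, c4 x hx w, c5 x hx w, c6 x hx w]
  have l0 : HH x 0 = _ := HH_lin x 0
  have l1 : HH x 1 = _ := HH_lin x 1
  have l2 : HH x 2 = _ := HH_lin x 2
  have l3 : HH x 3 = _ := HH_lin x 3
  rw [l0, l1, l2, l3]
  simp [det4, ka]
  ring
end
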